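/- arXiv:2208.04483 — 4 statements merged into one kernel-verified Lean document; each statement's English description precedes it below -/
import Mathlib

section
/- The trivial group Z_1 admits an oriented m-semiregular representation (OmSR) of valency two if and only if m ≥ 7. -/
/-- The arc relation of the `m`-Cayley digraph `Cay(G, T_{i,j} : i,j ∈ Z_m)`:
there is an arc from `(g,i)` to `(t*g, j)` for each `t ∈ T i j`. -/
def mCayleyArc {G : Type*} [Group G] {m : ℕ} (T : ZMod m → ZMod m → Set G) :
    G × ZMod m → G × ZMod m → Prop :=
  fun x y => ∃ t ∈ T x.2 y.2, y.1 = t * x.1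

/-- A permutation `σ` of the vertex set is an automorphism of the digraph with
arc relation `A` if it preserves the arc relation. -/
def IsDigraphAuto {V : Type*} (A : V → V → Prop) (σ : Equiv.Perm V) : Prop :=
  ∀ x y : V, A (σ x) (σ y) ↔ A x y

/-- A digraph is oriented if there are no loops and no pair of oppositely
directed arcs between any two vertices. -/
def IsOrientedRel {V : Type*} (A : V → V → Prop) : Prop :=
  ∀ x y : V, A x y → ¬ A y x

/-- The right translation `R(h) : (g,i) ↦ (g*h, i)` on the vertex set `G × Z_m`. -/
def rightTransl {G : Type*} [Group G] (m : ℕ) (h : G) : Equiv.Perm (G × ZMod m) :=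
  (Equiv.mulRight h).prodCongr (Equiv.refl (ZMod m))

/-- `G` admits an oriented `m`-semiregular representation (OmSR) of valency two:
there are connection sets `T i j ⊆ G` such that the corresponding `m`-Cayley
digraph is oriented, every vertex has exactly two out-neighbours and exactly two
in-neighbours, and the full automorphism group consists exactly of the right
translations `R(h)`, `h ∈ G`. -/
def HasOmSRValencyTwo (G : Type*) [Group G] (m : ℕ) : Prop :=
  ∃ T : ZMod m → ZMod m → Set G,
    IsOrientedRel (mCayleyArc T) ∧
    (∀ x : G × ZMod m, {y | mCayleyArc T x y}.ncard = 2) ∧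
    (∀ x : G × ZMod m, {y | mCayleyArc T y x}.ncard = 2) ∧
    (∀ σ : Equiv.Perm (G × ZMod m),
      IsDigraphAuto (mCayleyArc T) σ ↔ ∃ h : G, σ = rightTransl m h)

/-- An oriented digraph, regular of valency two, whose only automorphism is the identity. -/
def IsRigidTwoRegular {V : Type*} (A : V → V → Prop) : Prop :=
  IsOrientedRel A ∧ (∀ x, {y | A x y}.ncard = 2) ∧ (∀ x, {y | A y x}.ncard = 2) ∧
    ∀ σ : Equiv.Perm V, IsDigraphAuto A σ → σ = 1

theorem IsRigidTwoRegular.comap {V W : Type*} {A : W → W → Prop} (h : IsRigidTwoRegular A)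
    (e : V ≃ W) : IsRigidTwoRegular fun x y => A (e x) (e y) := by
  obtain ⟨ho, h₁, h₂, hr⟩ := h
  refine ⟨fun x y => ho _ _, fun x => ?_, fun x => ?_, fun σ hσ => ?_⟩
  · rw [← h₁ (e x)]
    exact Set.ncard_preimage_of_injective_subset_range (s := {y | A (e x) y}) e.injective (by simp)
  · rw [← h₂ (e x)]
    exact Set.ncard_preimage_of_injective_subset_range (s := {y | A y (e x)}) e.injective (by simp)
  · have := hr ((e.symm.trans σ).trans e) fun x y => by
      simpa using hσ (e.symm x) (e.symm y)
    ext x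
    simpa using congrArg e.symm (Equiv.congr_fun this (e x))

theorem rightTransl_eq_one {G : Type*} [Group G] [Subsingleton G] (m : ℕ) (h : G) :
    rightTransl m h = 1 :=
  Equiv.ext fun _ => Prod.ext (Subsingleton.elim _ _) rfl

theorem hasOmSRValencyTwo_iff_of_unique (G : Type*) [Group G] [Unique G] (m : ℕ) :
    HasOmSRValencyTwo G m ↔ ∃ A : ZMod m → ZMod m → Prop, IsRigidTwoRegular A := by
  constructor
  · rintro ⟨T, ho, h₁, h₂, hr⟩
    have hT : IsRigidTwoRegular (mCayleyArc T) := ⟨ho, h₁, h₂, fun σ hσ => by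
      obtain ⟨h, rfl⟩ := (hr σ).1 hσ
      exact rightTransl_eq_one m h⟩
    exact ⟨_, hT.comap (Equiv.uniqueProd (ZMod m) G).symm⟩
  · rintro ⟨A, hA⟩
    have hT : mCayleyArc (fun i j => {_t : G | A i j}) = fun x y => A x.2 y.2 := by
      ext x y
      exact ⟨fun ⟨_, h, _⟩ => h, fun h => ⟨1, h, Subsingleton.elim _ _⟩⟩
    obtain ⟨ho, h₁, h₂, hr⟩ := hA.comap (Equiv.uniqueProd (ZMod m) G)
    refine ⟨fun i j => {_t : G | A i j}, ?_⟩
    rw [hT]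
    refine ⟨ho, h₁, h₂, fun σ => ⟨fun hσ => ⟨1, ?_⟩, ?_⟩⟩
    · rw [rightTransl_eq_one]
      exact hr σ hσ
    · rintro ⟨h, rfl⟩ x y
      rw [rightTransl_eq_one]
      rfl

section Construction

/-- The successor of `i` on the cycle `0 → 1 → ⋯ → m - 1 → 0`. -/
def cycleSucc (m i : ℕ) : ℕ :=
  if i + 1 = m then 0 else i + 1

/-- The map `i ↦ i + 2` modulo `m`, with the images of `0`, `2`, `4` permuted cyclically. -/
def twistedSucc (m i : ℕ) : ℕ :=
  if i = 0 then 4 else if i = 2 then 6 else if i = 4 then 2 else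
    if i + 2 = m then 0 else if i + 1 = m then 1 else i + 2

/-- The digraph on `m` vertices with arcs `i → i + 1` and `i → i + 2`, except that the arcs
`0 → 2`, `2 → 4`, `4 → 6` are replaced by `0 → 4`, `2 → 6`, `4 → 2`. -/
def twistedArc (m : ℕ) (x y : Fin m) : Prop :=
  y.val = cycleSucc m x ∨ y.val = twistedSucc m x

variable {m : ℕ}

theorem twistedArc_oriented (hm : 7 ≤ m) : IsOrientedRel (twistedArc m) := by
  intro ⟨x, hx⟩ ⟨y, hy⟩
  simp only [twistedArc, cycleSucc, twistedSucc]
  grind (splits := 30)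

theorem ncard_twistedArc_out (hm : 7 ≤ m) (x : Fin m) : {y | twistedArc m x y}.ncard = 2 := by
  obtain ⟨x, hx⟩ := x
  refine Set.ncard_eq_two.2 ⟨⟨cycleSucc m x, ?_⟩, ⟨twistedSucc m x, ?_⟩, ?_, ?_⟩
  · grind [cycleSucc]
  · grind [twistedSucc]
  · grind [cycleSucc, twistedSucc]
  · ext y
    simp [twistedArc, Fin.ext_iff]

theorem ncard_twistedArc_in (hm : 7 ≤ m) (x : Fin m) : {y | twistedArc m y x}.ncard = 2 := by
  obtain ⟨x, hx⟩ := x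
  refine Set.ncard_eq_two.2 ⟨⟨if x = 0 then m - 1 else x - 1, ?_⟩,
    ⟨if x = 4 then 0 else if x = 6 then 2 else if x = 2 then 4 else
      if x = 0 then m - 2 else if x = 1 then m - 1 else x - 2, ?_⟩, ?_, ?_⟩
  · grind
  · grind
  · grind
  · ext ⟨y, hy⟩
    simp only [twistedArc, cycleSucc, twistedSucc, Set.mem_ofPred_eq, Set.mem_insert_iff,
      Set.mem_singleton_iff, Fin.mk.injEq]
    grind (splits := 30)

/-- The out-neighbours of every vertex other than `0`, `2`, `4` are adjacent. -/
theorem exists_twistedArc_triangle_iff (hm : 7 ≤ m) (x : Fin m) :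
    (∃ y z, twistedArc m x y ∧ twistedArc m x z ∧ twistedArc m y z) ↔
      ¬(x.val = 0 ∨ x.val = 2 ∨ x.val = 4) := by
  obtain ⟨x, hx⟩ := x
  constructor
  · rintro ⟨⟨y, hy⟩, ⟨z, hz⟩, h⟩
    simp only [twistedArc, cycleSucc, twistedSucc] at h
    grind (splits := 30)
  · intro h
    refine ⟨⟨cycleSucc m x, ?_⟩, ⟨twistedSucc m x, ?_⟩, Or.inl rfl, Or.inr rfl, Or.inl ?_⟩ <;>
    grind [cycleSucc, twistedSucc]

theorem twistedArc_path (hm : 7 ≤ m) {x y : Fin m} (hx : x.val = 0 ∨ x.val = 2 ∨ x.val = 4)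
    (hy : y.val = 0 ∨ y.val = 2 ∨ y.val = 4) (h : twistedArc m x y) :
    x.val = 0 ∧ y.val = 4 ∨ x.val = 4 ∧ y.val = 2 := by
  simp only [twistedArc, cycleSucc, twistedSucc] at h
  rcases hx with hx | hx | hx <;> simp only [hx] at h ⊢ <;> grind

/-- An automorphism fixing a vertex and one of its two out-neighbours fixes the other one. -/
theorem IsDigraphAuto.fix_out {V : Type*} {A : V → V → Prop} {σ : Equiv.Perm V}
    (hσ : IsDigraphAuto A σ) {x y z : V} (hA : ∀ w, A x w ↔ w = y ∨ w = z) (hyz : y ≠ z)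
    (hx : σ x = x) (hy : σ y = y) : σ z = z := by
  have h : A x (σ z) := by
    rw [← hx, hσ, hA]
    exact Or.inr rfl
  refine ((hA _).1 h).resolve_left fun h => hyz ?_
  exact σ.injective (hy.trans h.symm)

theorem cycleSucc_eq {i : ℕ} (h : i + 1 < m) : cycleSucc m i = i + 1 :=
  if_neg h.ne

theorem twistedSucc_eq {i : ℕ} (h : i + 2 < m) (h₀ : i ≠ 0) (h₂ : i ≠ 2) (h₄ : i ≠ 4) :
    twistedSucc m i = i + 2 := by
  grind [twistedSucc]

theorem twistedArc_fix_out {σ : Equiv.Perm (Fin m)} (hσ : IsDigraphAuto (twistedArc m) σ)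
    {x y z : ℕ} {hx : x < m} {hy : y < m} (hz : z < m) (hyz : y ≠ z)
    (h : cycleSucc m x = y ∧ twistedSucc m x = z ∨ cycleSucc m x = z ∧ twistedSucc m x = y)
    (fx : σ ⟨x, hx⟩ = ⟨x, hx⟩) (fy : σ ⟨y, hy⟩ = ⟨y, hy⟩) : σ ⟨z, hz⟩ = ⟨z, hz⟩ := by
  refine hσ.fix_out (fun w => ?_) (by simpa using hyz) fx fy
  simp only [twistedArc, Fin.ext_iff]
  grind

theorem twistedArc_rigid (hm : 7 ≤ m) (σ : Equiv.Perm (Fin m))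
    (hσ : IsDigraphAuto (twistedArc m) σ) : σ = 1 := by
  have hT (x : Fin m) (hx : x.val = 0 ∨ x.val = 2 ∨ x.val = 4) :
      (σ x).val = 0 ∨ (σ x).val = 2 ∨ (σ x).val = 4 := by
    by_contra h
    refine (exists_twistedArc_triangle_iff hm x).1 ?_ hx
    obtain ⟨y, z, h⟩ := (exists_twistedArc_triangle_iff hm (σ x)).2 h
    refine ⟨σ.symm y, σ.symm z, ?_, ?_, ?_⟩ <;> rw [← hσ] <;> simp [h]
  have h₀ := hT ⟨0, by omega⟩ (by simp)
  have h₂ := hT ⟨2, by omega⟩ (by simp)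
  have h₄ := hT ⟨4, by omega⟩ (by simp)
  have h₀₄ := (hσ ⟨0, by omega⟩ ⟨4, by omega⟩).2 (by simp [twistedArc, twistedSucc])
  have h₄₂ := (hσ ⟨4, by omega⟩ ⟨2, by omega⟩).2 (by simp [twistedArc, twistedSucc])
  have h₀₄' := twistedArc_path hm h₀ h₄ h₀₄
  have h₄₂' := twistedArc_path hm h₄ h₂ h₄₂
  have f₀ : σ ⟨0, by omega⟩ = ⟨0, by omega⟩ := Fin.ext (by dsimp only; omega)
  have f₂ : σ ⟨2, by omega⟩ = ⟨2, by omega⟩ := Fin.ext (by dsimp only; omega)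
  have f₄ : σ ⟨4, by omega⟩ = ⟨4, by omega⟩ := Fin.ext (by dsimp only; omega)
  have f₁ : σ ⟨1, by omega⟩ = ⟨1, by omega⟩ :=
    twistedArc_fix_out hσ (y := 4) _ (by decide) (Or.inr ⟨cycleSucc_eq (by omega), rfl⟩) f₀ f₄
  have f₃ : σ ⟨3, by omega⟩ = ⟨3, by omega⟩ :=
    twistedArc_fix_out hσ _ (by decide) (Or.inl ⟨cycleSucc_eq (by omega),
      twistedSucc_eq (by omega) (by decide) (by decide) (by decide)⟩) f₁ f₂
  have f₅ : σ ⟨5, by omega⟩ = ⟨5, by omega⟩ :=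
    twistedArc_fix_out hσ _ (by decide) (Or.inl ⟨cycleSucc_eq (by omega),
      twistedSucc_eq (by omega) (by decide) (by decide) (by decide)⟩) f₃ f₄
  have f₆ : σ ⟨6, by omega⟩ = ⟨6, by omega⟩ :=
    twistedArc_fix_out hσ _ (by decide) (Or.inl ⟨cycleSucc_eq (by omega), rfl⟩) f₂ f₃
  have hfix (i : ℕ) : ∀ hi : i < m, σ ⟨i, hi⟩ = ⟨i, hi⟩ := by
    induction i using Nat.strong_induction_on with
    | _ i ih =>
      intro hi
      by_cases h : i < 7
      · interval_cases i <;> assumption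
      · obtain ⟨k, rfl⟩ : ∃ k, i = k + 2 := ⟨i - 2, by omega⟩
        exact twistedArc_fix_out hσ hi (by omega) (Or.inl ⟨cycleSucc_eq (by omega),
          twistedSucc_eq hi (by omega) (by omega) (by omega)⟩)
          (ih k (by omega) (by omega)) (ih (k + 1) (by omega) (by omega))
  exact Equiv.ext fun x => hfix x x.2

theorem twistedArc_isRigidTwoRegular (hm : 7 ≤ m) : IsRigidTwoRegular (twistedArc m) :=
  ⟨twistedArc_oriented hm, ncard_twistedArc_out hm, ncard_twistedArc_in hm, twistedArc_rigid hm⟩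

end Construction

section SmallOrder

/-- Whether `x` is an entry of the pair `r`, which lists the out-neighbours of a vertex. -/
def isOut (r : ℕ × ℕ) (x : ℕ) : Bool :=
  r.1.beq x || r.2.beq x

/-- Whether the list `l` of the out-neighbourhoods of the vertices `0, …, l.length - 1` of an
oriented digraph with in-valency at most two can be followed by `r`. -/
def canExtend (l : List (ℕ × ℕ)) (r : ℕ × ℕ) : Bool :=
  !isOut r l.length &&
  (List.range l.length).all fun i =>
    !(isOut r i && isOut (l.getD i 0) l.length) &&
    (List.range i).all fun j =>
      !(isOut (l.getD i 0) r.1 && isOut (l.getD j 0) r.1) &&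
      !(isOut (l.getD i 0) r.2 && isOut (l.getD j 0) r.2)

/-- Whether the list `p` of values is a nontrivial automorphism of the digraph on `n` vertices
with out-neighbourhoods `l`. -/
def isListAuto (n : ℕ) (l : List (ℕ × ℕ)) (p : List ℕ) : Bool :=
  (List.range n).all (fun i => (p.getD i 0).blt n &&
    (List.range i).all (fun j => !(p.getD i 0).beq (p.getD j 0)) &&
    isOut (l.getD (p.getD i 0) 0) (p.getD (l.getD i 0).1 0) &&
    isOut (l.getD (p.getD i 0) 0) (p.getD (l.getD i 0).2 0)) &&
  (List.range n).any fun i => !(p.getD i 0).beq i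

/-- Backtracking search for a nontrivial automorphism that extends `p` by `k` more values. -/
def existsListAuto (n : ℕ) (l : List (ℕ × ℕ)) : ℕ → List ℕ → Bool
  | 0, p => isListAuto n l p
  | k + 1, p => (List.range n).any fun v =>
      (List.range p.length).all (fun j =>
        !(p.getD j 0).beq v &&
        (isOut (l.getD j 0) p.length == isOut (l.getD (p.getD j 0) 0) v) &&
        (isOut (l.getD p.length 0) j == isOut (l.getD v 0) (p.getD j 0))) &&
      existsListAuto n l k (p ++ [v])

/-- Whether all extensions of `l` by `k` more out-neighbourhoods have a nontrivial automorphism. -/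
def noneRigid (n : ℕ) : ℕ → List (ℕ × ℕ) → Bool
  | 0, l => existsListAuto n l n []
  | k + 1, l => (List.range n).all fun a => (List.range a).all fun b =>
      !canExtend l (a, b) || noneRigid n k (l ++ [(a, b)])

theorem noneRigid_of_le_six : ∀ n < 7, 3 ≤ n → noneRigid n (n - 1) [(2, 1)] := by
  decide +kernel

theorem isOut_iff {r : ℕ × ℕ} {x : ℕ} : isOut r x ↔ x = r.1 ∨ x = r.2 := by
  simp [isOut, eq_comm (a := x)]

theorem exists_isListAuto_of_existsListAuto {n : ℕ} {l : List (ℕ × ℕ)} {k : ℕ} {p : List ℕ}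
    (h : existsListAuto n l k p) : ∃ q, isListAuto n l q := by
  induction k generalizing p with
  | zero => exact ⟨p, h⟩
  | succ k ih =>
    simp only [existsListAuto, List.any_eq_true, Bool.and_eq_true] at h
    obtain ⟨v, _, _, h⟩ := h
    exact ih h

/-- The list of the first `k` values of `r`. -/
def outList (r : ℕ → ℕ × ℕ) (k : ℕ) : List (ℕ × ℕ) :=
  (List.range k).map r

theorem outList_getD (r : ℕ → ℕ × ℕ) {k i : ℕ} (h : i < k) : (outList r k).getD i 0 = r i := by
  simp [outList, h]

theorem outList_length (r : ℕ → ℕ × ℕ) (k : ℕ) : (outList r k).length = k := by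
  simp [outList]

theorem canExtend_outList {r : ℕ → ℕ × ℕ} {k : ℕ}
    (ho : ∀ i ≤ k, isOut (r k) i → ¬isOut (r i) k)
    (hi : ∀ x, ∀ i < k, ∀ j < i, isOut (r k) x → isOut (r i) x → ¬isOut (r j) x) :
    canExtend (outList r k) (r k) := by
  simp only [canExtend, outList_length, Bool.and_eq_true, Bool.not_eq_true', List.all_eq_true,
    List.mem_range, Bool.and_eq_false_iff]
  refine ⟨?_, fun i hik => ⟨?_, fun j hj => ?_⟩⟩
  · grind
  · grind [outList_getD]
  · rw [outList_getD r hik, outList_getD r (hj.trans hik)]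
    have h₁ := hi (r k).1 i hik j hj (isOut_iff.2 (Or.inl rfl))
    have h₂ := hi (r k).2 i hik j hj (isOut_iff.2 (Or.inr rfl))
    grind

theorem existsListAuto_of_noneRigid {n : ℕ} {r : ℕ → ℕ × ℕ}
    (hr : ∀ i < n, (r i).1 < n ∧ (r i).2 < (r i).1)
    (ho : ∀ i < n, ∀ j < n, isOut (r i) j → ¬isOut (r j) i)
    (hi : ∀ x, ∀ k < n, ∀ i < k, ∀ j < i, isOut (r k) x → isOut (r i) x → ¬isOut (r j) x)
    {f k : ℕ} (hk : k + f = n) (h : noneRigid n f (outList r k)) :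
    existsListAuto n (outList r n) n [] := by
  induction f generalizing k with
  | zero =>
    obtain rfl : k = n := hk
    exact h
  | succ f ih =>
    refine ih (k := k + 1) (by omega) ?_
    simp only [noneRigid, List.all_eq_true, List.mem_range, Bool.or_eq_true,
      Bool.not_eq_true'] at h
    have hc : canExtend (outList r k) (r k) :=
      canExtend_outList (fun i hi => ho k (by omega) i (by omega)) fun x => hi x k (by omega)
    have := (h _ (hr k (by omega)).1 _ (hr k (by omega)).2).resolve_left (by simp [hc])
    simpa [outList, List.range_succ] using this

theorem exists_auto_of_isListAuto {n : ℕ} {r : ℕ → ℕ × ℕ} {A : Fin n → Fin n → Prop}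
    (hr : ∀ i < n, (r i).1 < n ∧ (r i).2 < (r i).1) (hA : ∀ i j : Fin n, A i j ↔ isOut (r i) j)
    {p : List ℕ} (h : isListAuto n (outList r n) p) :
    ∃ σ : Equiv.Perm (Fin n), IsDigraphAuto A σ ∧ σ ≠ 1 := by
  simp only [isListAuto, Bool.and_eq_true, List.all_eq_true, List.any_eq_true, List.mem_range,
    Nat.blt_eq, Bool.not_eq_true', ← Bool.not_eq_true, Nat.beq_eq] at h
  obtain ⟨h, i, hi, hpi⟩ := h
  have hinj (i j : ℕ) (hi : i < n) (hj : j < n) (hij : p.getD i 0 = p.getD j 0) : i = j := by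
    rcases lt_trichotomy i j with hlt | rfl | hlt
    · exact absurd hij.symm ((h j hj).1.1.2 i hlt)
    · rfl
    · exact absurd hij ((h i hi).1.1.2 j hlt)
  let f (i : Fin n) : Fin n := ⟨p.getD i 0, (h i i.2).1.1.1⟩
  have hf : f.Injective := fun i j hij => Fin.ext (hinj i j i.2 j.2 (congrArg Fin.val hij))
  refine ⟨Equiv.ofBijective f (Finite.injective_iff_bijective.1 hf), fun x y => ?_, fun h1 => ?_⟩
  · obtain ⟨⟨⟨hx, -⟩, h₁⟩, h₂⟩ := h x x.2
    rw [outList_getD r x.2, outList_getD r hx, isOut_iff] at h₁ h₂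
    have hr' := hr x x.2
    have h₁₂ := hinj (r x).1 (r x).2 hr'.1 (hr'.2.trans hr'.1)
    have hy₁ := hinj y (r x).1 y.2 hr'.1
    have hy₂ := hinj y (r x).2 y.2 (hr'.2.trans hr'.1)
    simp only [hA, isOut_iff, Equiv.ofBijective_apply, f]
    grind
  · exact hpi (congrArg Fin.val (Equiv.congr_fun h1 ⟨i, hi⟩))

theorem not_isRigidTwoRegular_of_le_six {n : ℕ} (hn : 3 ≤ n) (hn' : n < 7)
    {A : Fin n → Fin n → Prop} (h₁ : A ⟨0, by omega⟩ ⟨1, by omega⟩)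
    (h₂ : A ⟨0, by omega⟩ ⟨2, by omega⟩) : ¬IsRigidTwoRegular A := by
  rintro ⟨ho, hout, hin, hrigid⟩
  have hex (i : ℕ) : ∃ r : ℕ × ℕ, ∀ hi : i < n,
      (r.1 < n ∧ r.2 < r.1) ∧ ∀ j : Fin n, A ⟨i, hi⟩ j ↔ isOut r j := by
    by_cases hi : i < n
    · obtain ⟨a, b, hab, hs⟩ := Set.ncard_eq_two.1 (hout ⟨i, hi⟩)
      have hs' (j : Fin n) : A ⟨i, hi⟩ j ↔ j = a ∨ j = b := Set.ext_iff.1 hs j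
      rcases hab.lt_or_gt with hlt | hlt
      · exact ⟨(b, a), fun _ => ⟨⟨b.2, hlt⟩, fun j => by
          rw [hs', isOut_iff, Fin.ext_iff, Fin.ext_iff, or_comm]⟩⟩
      · exact ⟨(a, b), fun _ => ⟨⟨a.2, hlt⟩, fun j => by
          rw [hs', isOut_iff, Fin.ext_iff, Fin.ext_iff]⟩⟩
    · exact ⟨0, fun h => absurd h hi⟩
  choose r hr using hex
  have hlt (i : ℕ) (hi : i < n) (x : ℕ) (h : isOut (r i) x) : x < n := by
    have := hr i hi
    grind [isOut_iff]
  have hA (i j : ℕ) (hi : i < n) (h : isOut (r i) j) : A ⟨i, hi⟩ ⟨j, hlt i hi j h⟩ :=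
    ((hr i hi).2 _).2 h
  have hr₀ : r 0 = (2, 1) := by
    obtain ⟨⟨-, hlt⟩, h⟩ := hr 0 (by omega)
    have h₁ := isOut_iff.1 ((h _).1 h₁)
    have h₂ := isOut_iff.1 ((h _).1 h₂)
    ext <;> grind
  have hsearch : noneRigid n (n - 1) (outList r 1) := by
    simpa [outList, hr₀] using noneRigid_of_le_six n hn' hn
  obtain ⟨p, hp⟩ := exists_isListAuto_of_existsListAuto <| existsListAuto_of_noneRigid
    (fun i hi => (hr i hi).1) (fun i hi j hj hij hji => ho _ _ (hA i j hi hij) (hA j i hj hji))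
    (fun x k hk i hik j hji hkx hix hjx => by
      obtain ⟨a, b, -, hs⟩ := Set.ncard_eq_two.1 (hin ⟨x, hlt k hk x hkx⟩)
      have hk' := hs.subset (hA k x hk hkx)
      have hi' := hs.subset (hA i x (hik.trans hk) hix)
      have hj' := hs.subset (hA j x ((hji.trans hik).trans hk) hjx)
      simp only [Set.mem_insert_iff, Set.mem_singleton_iff, Fin.ext_iff] at hk' hi' hj'
      omega)
    (by omega) hsearch
  obtain ⟨σ, hσ, hne⟩ := exists_auto_of_isListAuto (fun i hi => (hr i hi).1)
    (fun i j => (hr i i.2).2 j) hp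
  exact hne (hrigid σ hσ)

end SmallOrder

theorem IsRigidTwoRegular.seven_le_card {V : Type*} [Fintype V] [Nonempty V] {A : V → V → Prop}
    (h : IsRigidTwoRegular A) : 7 ≤ Fintype.card V := by
  obtain ⟨v⟩ := ‹Nonempty V›
  obtain ⟨a, b, hab, hs⟩ := Set.ncard_eq_two.1 (h.2.1 v)
  have ha : A v a := hs.superset (by simp)
  have hb : A v b := hs.superset (by simp)
  have hva : v ≠ a := fun h' => h.1 v v (h' ▸ ha) (h' ▸ ha)
  have hvb : v ≠ b := fun h' => h.1 v v (h' ▸ hb) (h' ▸ hb)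
  have hinj : Function.Injective ![v, a, b] := by
    intro i j
    fin_cases i <;> fin_cases j <;> simp [hva, hvb, hab, hva.symm, hvb.symm, hab.symm]
  have hcard : 3 ≤ Fintype.card V := by
    simpa using Fintype.card_le_of_injective _ hinj
  by_contra! hlt
  let e₀ := Fintype.equivFin V
  have := Equiv.Perm.isMultiplyPretransitive V 3
  obtain ⟨g, hg⟩ := MulAction.exists_smul_eq (Equiv.Perm V)
    ((Fin.castLEEmb hcard).trans e₀.symm.toEmbedding) ⟨_, hinj⟩
  have he (i : Fin 3) : g (e₀.symm (Fin.castLE hcard i)) = ![v, a, b] i :=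
    congrArg (fun f : Fin 3 ↪ V => f i) hg
  let e : Fin (Fintype.card V) ≃ V := e₀.symm.trans g
  have h₀ : e ⟨0, by omega⟩ = v := he 0
  have h₁ : e ⟨1, by omega⟩ = a := he 1
  have h₂ : e ⟨2, by omega⟩ = b := he 2
  exact not_isRigidTwoRegular_of_le_six hcard hlt (A := fun x y => A (e x) (e y))
    (by rwa [h₀, h₁]) (by rwa [h₀, h₂]) (h.comap e)

/-- The trivial group `Z_1` admits an OmSR of valency two iff `m ≥ 7`. -/
theorem trivial_group_omsr_valency_two (m : ℕ) (hm : 1 ≤ m) :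
    HasOmSRValencyTwo (Multiplicative (ZMod 1)) m ↔ 7 ≤ m := by
  have : NeZero m := ⟨by omega⟩
  rw [hasOmSRValencyTwo_iff_of_unique]
  constructor
  · rintro ⟨A, hA⟩
    simpa [ZMod.card] using hA.seven_le_card
  · intro hm'
    exact ⟨_, (twistedArc_isRigidTwoRegular hm').comap (ZMod.finEquiv m).symm.toEquiv⟩
end

section
/- The elementary abelian group Z_2 × Z_2 admits an oriented m-semiregular representation (OmSR) of valency two if and only if m ≥ 3. -/
/-- The Klein four-group `Z_2 × Z_2`, written multiplicatively. -/
abbrev Klein := Multiplicative (ZMod 2 × ZMod 2)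

namespace Klein

/-- The first generator. -/
def a : Klein := Multiplicative.ofAdd (1, 0)

/-- The second generator. -/
def b : Klein := Multiplicative.ofAdd (0, 1)

theorem inv_eq_self : ∀ t : Klein, t⁻¹ = t := by decide

theorem a_ne_one : a ≠ 1 := by decide

theorem b_ne_one : b ≠ 1 := by decide

theorem a_ne_b : a ≠ b := by decide

theorem eq_mul_one_of_comm (π : Klein → Klein) (ha : ∀ g, π (a * g) = a * π g)
    (hb : ∀ g, π (b * g) = b * π g) (g : Klein) : π g = g * π 1 := by
  have key : ∀ g : Klein, g = 1 ∨ g = a * 1 ∨ g = b * 1 ∨ g = a * (b * 1) := by decide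
  rcases key g with h | h | h | h <;> subst h <;> simp only [ha, hb, one_mul, mul_assoc]

end Klein

open Klein

section General

variable {G : Type*} [Group G] {m : ℕ} {T : ZMod m → ZMod m → Set G}

theorem mCayleyArc_iff (x y : G × ZMod m) :
    mCayleyArc T x y ↔ y.1 * x.1⁻¹ ∈ T x.2 y.2 := by
  constructor
  · rintro ⟨t, ht, h⟩
    simpa [h] using ht
  · intro h
    exact ⟨_, h, by simp⟩

theorem isDigraphAuto_rightTransl (h : G) :
    IsDigraphAuto (mCayleyArc T) (rightTransl m h) := by
  intro x y
  simp [mCayleyArc_iff, rightTransl, mul_assoc]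

theorem IsDigraphAuto.symm {V : Type*} {A : V → V → Prop} {σ : Equiv.Perm V}
    (hσ : IsDigraphAuto A σ) : IsDigraphAuto A σ.symm := by
  intro x y
  simpa using (hσ (σ.symm x) (σ.symm y)).symm

theorem ncard_out_eq_two {i : ZMod m}
    (h : ∃ p q : G × ZMod m, p ≠ q ∧ ∀ r : G × ZMod m, r.1 ∈ T i r.2 ↔ r = p ∨ r = q) (g : G) :
    {y | mCayleyArc T (g, i) y}.ncard = 2 := by
  obtain ⟨p, q, hne, h⟩ := h
  rw [Set.ncard_eq_two]
  refine ⟨(p.1 * g, p.2), (q.1 * g, q.2), ?_, ?_⟩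
  · simpa [Prod.ext_iff] using hne
  · ext ⟨y, j⟩
    have := h (y * g⁻¹, j)
    simpa [mCayleyArc_iff, Prod.ext_iff, mul_inv_eq_iff_eq_mul] using this

theorem ncard_in_eq_two {j : ZMod m}
    (h : ∃ p q : G × ZMod m, p ≠ q ∧ ∀ r : G × ZMod m, r.1 ∈ T r.2 j ↔ r = p ∨ r = q) (g : G) :
    {y | mCayleyArc T y (g, j)}.ncard = 2 := by
  obtain ⟨p, q, hne, h⟩ := h
  rw [Set.ncard_eq_two]
  refine ⟨(p.1⁻¹ * g, p.2), (q.1⁻¹ * g, q.2), ?_, ?_⟩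
  · simpa [Prod.ext_iff] using hne
  · ext ⟨y, i⟩
    have := h (g * y⁻¹, i)
    have key : ∀ t : G, g * y⁻¹ = t ↔ y = t⁻¹ * g := fun t => by
      rw [mul_inv_eq_iff_eq_mul, eq_inv_mul_iff_mul_eq, eq_comm]
    simpa [mCayleyArc_iff, Prod.ext_iff, key] using this

theorem IsDigraphAuto.fst_apply_mul {σ : Equiv.Perm (G × ZMod m)}
    (hσ : IsDigraphAuto (mCayleyArc T) σ) (hlayer : ∀ x, (σ x).2 = x.2) {i j : ZMod m} {t : G}
    (hT : ∀ s, s ∈ T i j ↔ s = t) (g : G) : (σ (t * g, j)).1 = t * (σ (g, i)).1 := by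
  have h := (hσ (g, i) (t * g, j)).2 ⟨t, (hT t).2 rfl, rfl⟩
  rw [mCayleyArc_iff, hlayer, hlayer, hT] at h
  exact mul_inv_eq_iff_eq_mul.1 h

end General

theorem eq_rightTransl_of_layers {m : ℕ} {σ : Equiv.Perm (Klein × ZMod m)}
    (hlayer : ∀ x, (σ x).2 = x.2) (hconst : ∀ g i, (σ (g, i)).1 = (σ (g, 0)).1)
    (ha : ∀ g, (σ (a * g, 0)).1 = a * (σ (g, 0)).1)
    (hb : ∀ g, (σ (b * g, 0)).1 = b * (σ (g, 0)).1) :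
    ∃ h : Klein, σ = rightTransl m h := by
  refine ⟨(σ (1, 0)).1, Equiv.ext fun ⟨g, i⟩ => ?_⟩
  refine Prod.ext ?_ (hlayer _)
  rw [hconst]
  exact eq_mul_one_of_comm (fun g => (σ (g, 0)).1) ha hb g

/-- Reduction of the OmSR property for the Klein four-group to conditions on connection sets,
together with rigidity of the digraph. -/
theorem hasOmSRValencyTwo_of {m : ℕ} (T : ZMod m → ZMod m → Set Klein)
    (hor : ∀ i j t, t ∈ T i j → t ∉ T j i)
    (hout : ∀ i, ∃ p q : Klein × ZMod m, p ≠ q ∧ ∀ r : Klein × ZMod m,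
      r.1 ∈ T i r.2 ↔ r = p ∨ r = q)
    (hin : ∀ j, ∃ p q : Klein × ZMod m, p ≠ q ∧ ∀ r : Klein × ZMod m,
      r.1 ∈ T r.2 j ↔ r = p ∨ r = q)
    (hrig : ∀ σ, IsDigraphAuto (mCayleyArc T) σ → ∃ h : Klein, σ = rightTransl m h) :
    HasOmSRValencyTwo Klein m := by
  refine ⟨T, fun x y hxy hyx => ?_, fun x => ncard_out_eq_two (hout x.2) x.1,
    fun x => ncard_in_eq_two (hin x.2) x.1, fun σ => ⟨hrig σ, ?_⟩⟩
  · rw [mCayleyArc_iff] at hxy hyx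
    refine hor _ _ _ hxy ?_
    rw [← inv_eq_self (y.1 * x.1⁻¹)]
    simpa using hyx
  · rintro ⟨h, rfl⟩
    exact isDigraphAuto_rightTransl h

section Three

/-- Connection sets for `m = 3`. -/
def conn₃ (i j : ZMod 3) : Set Klein :=
  {t | (j = i + 1 ∧ t = 1) ∨ (i = j + 1 ∧ t = if j = 2 then b else a)}

instance (i j : ZMod 3) (t : Klein) : Decidable (t ∈ conn₃ i j) :=
  inferInstanceAs (Decidable ((j = i + 1 ∧ t = 1) ∨ (i = j + 1 ∧ t = if j = 2 then b else a)))

instance : DecidableRel (mCayleyArc conn₃) := fun x y =>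
  decidable_of_iff _ (mCayleyArc_iff x y).symm

theorem conn₃_layer_one_iff : ∀ x : Klein × ZMod 3, x.2 = 1 ↔
    ∃ y, mCayleyArc conn₃ x y ∧ ∃ z, mCayleyArc conn₃ x z ∧ y ≠ z ∧
      ∃ w, mCayleyArc conn₃ y w ∧ mCayleyArc conn₃ z w := by
  decide +kernel

theorem conn₃_layer_two_iff : ∀ x : Klein × ZMod 3, x.2 = 2 ↔
    ∃ y, y.2 = 1 ∧ mCayleyArc conn₃ y x ∧ ∃ z, mCayleyArc conn₃ x z ∧ mCayleyArc conn₃ z y := by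
  decide +kernel

theorem conn₃_layer {σ : Equiv.Perm (Klein × ZMod 3)} (hσ : IsDigraphAuto (mCayleyArc conn₃) σ)
    (x : Klein × ZMod 3) : (σ x).2 = x.2 := by
  have one : ∀ σ : Equiv.Perm (Klein × ZMod 3), IsDigraphAuto (mCayleyArc conn₃) σ →
      ∀ x, x.2 = 1 → (σ x).2 = 1 := by
    intro σ hσ x hx
    obtain ⟨y, hy, z, hz, hne, w, hyw, hzw⟩ := (conn₃_layer_one_iff x).1 hx
    exact (conn₃_layer_one_iff _).2 ⟨σ y, (hσ _ _).2 hy, σ z, (hσ _ _).2 hz, σ.injective.ne hne,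
      σ w, (hσ _ _).2 hyw, (hσ _ _).2 hzw⟩
  have two : ∀ σ : Equiv.Perm (Klein × ZMod 3), IsDigraphAuto (mCayleyArc conn₃) σ →
      ∀ x, x.2 = 2 → (σ x).2 = 2 := by
    intro σ hσ x hx
    obtain ⟨y, hy, hyx, z, hz, hzy⟩ := (conn₃_layer_two_iff x).1 hx
    exact (conn₃_layer_two_iff _).2 ⟨σ y, one σ hσ y hy, (hσ _ _).2 hyx, σ z, (hσ _ _).2 hz,
      (hσ _ _).2 hzy⟩
  have cases : ∀ i j : ZMod 3, (i = 1 → j = 1) → (i = 2 → j = 2) → (j = 1 → i = 1) →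
      (j = 2 → i = 2) → j = i := by decide
  refine cases _ _ (one σ hσ x) (two σ hσ x) (fun h => ?_) (fun h => ?_)
  · simpa using one _ hσ.symm _ h
  · simpa using two _ hσ.symm _ h

set_option synthInstance.maxHeartbeats 200000 in
set_option synthInstance.maxSize 1000 in
theorem hasOmSRValencyTwo_three : HasOmSRValencyTwo Klein 3 := by
  refine hasOmSRValencyTwo_of conn₃ (by decide +kernel) (by decide +kernel) (by decide +kernel)
    fun σ hσ => ?_
  have hlayer := conn₃_layer hσ
  have h₁ (g) : (σ (g, 1)).1 = (σ (g, 0)).1 := by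
    simpa using hσ.fst_apply_mul hlayer (i := 0) (j := 1) (t := 1) (by decide) g
  have h₂ (g) : (σ (g, 2)).1 = (σ (g, 0)).1 := by
    simpa [h₁] using hσ.fst_apply_mul hlayer (i := 1) (j := 2) (t := 1) (by decide) g
  refine eq_rightTransl_of_layers hlayer (fun g i => ?_) (fun g => ?_) (fun g => ?_)
  · have : ∀ i : ZMod 3, i = 0 ∨ i = 1 ∨ i = 2 := by decide
    rcases this i with rfl | rfl | rfl
    exacts [rfl, h₁ g, h₂ g]
  · simpa only [h₁] using hσ.fst_apply_mul hlayer (i := 1) (j := 0) (t := a) (by decide) g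
  · simpa only [h₂] using hσ.fst_apply_mul hlayer (i := 0) (j := 2) (t := b) (by decide) g

end Three

section Four

/-- Connection sets for `m = 4`. -/
def conn₄ (i j : ZMod 4) : Set Klein :=
  {t | (j = i + 1 ∧ t = 1) ∨ (i = 0 ∧ j = 1 ∧ t = a) ∨ (i = 1 ∧ j = 3 ∧ t = 1) ∨
    (i = 2 ∧ j = 0 ∧ t = b) ∨ (i = 3 ∧ j = 2 ∧ t = a)}

instance (i j : ZMod 4) (t : Klein) : Decidable (t ∈ conn₄ i j) :=
  inferInstanceAs (Decidable ((j = i + 1 ∧ t = 1) ∨ (i = 0 ∧ j = 1 ∧ t = a) ∨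
    (i = 1 ∧ j = 3 ∧ t = 1) ∨ (i = 2 ∧ j = 0 ∧ t = b) ∨ (i = 3 ∧ j = 2 ∧ t = a)))

instance : DecidableRel (mCayleyArc conn₄) := fun x y =>
  decidable_of_iff _ (mCayleyArc_iff x y).symm

theorem conn₄_layer_zero_iff : ∀ x : Klein × ZMod 4, x.2 = 0 ↔
    ∃ y, y ≠ x ∧ ∀ z, mCayleyArc conn₄ x z → mCayleyArc conn₄ y z := by
  decide +kernel

theorem conn₄_layer_one_iff : ∀ x : Klein × ZMod 4, x.2 = 1 ↔
    ∃ y, y.2 = 0 ∧ mCayleyArc conn₄ y x := by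
  decide +kernel

theorem conn₄_layer_two_iff : ∀ x : Klein × ZMod 4, x.2 ≠ 2 ↔
    ∃ y, mCayleyArc conn₄ x y ∧ ∃ z, mCayleyArc conn₄ y z ∧ mCayleyArc conn₄ z x := by
  decide +kernel

theorem conn₄_layer {σ : Equiv.Perm (Klein × ZMod 4)} (hσ : IsDigraphAuto (mCayleyArc conn₄) σ)
    (x : Klein × ZMod 4) : (σ x).2 = x.2 := by
  have zero : ∀ σ : Equiv.Perm (Klein × ZMod 4), IsDigraphAuto (mCayleyArc conn₄) σ →
      ∀ x, x.2 = 0 → (σ x).2 = 0 := by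
    intro σ hσ x hx
    obtain ⟨y, hne, hy⟩ := (conn₄_layer_zero_iff x).1 hx
    refine (conn₄_layer_zero_iff _).2 ⟨σ y, σ.injective.ne hne, fun z hz => ?_⟩
    obtain ⟨z, rfl⟩ := σ.surjective z
    exact (hσ _ _).2 (hy z ((hσ _ _).1 hz))
  have one : ∀ σ : Equiv.Perm (Klein × ZMod 4), IsDigraphAuto (mCayleyArc conn₄) σ →
      ∀ x, x.2 = 1 → (σ x).2 = 1 := by
    intro σ hσ x hx
    obtain ⟨y, hy, hyx⟩ := (conn₄_layer_one_iff x).1 hx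
    exact (conn₄_layer_one_iff _).2 ⟨σ y, zero σ hσ y hy, (hσ _ _).2 hyx⟩
  have two : ∀ σ : Equiv.Perm (Klein × ZMod 4), IsDigraphAuto (mCayleyArc conn₄) σ →
      ∀ x, x.2 ≠ 2 → (σ x).2 ≠ 2 := by
    intro σ hσ x hx
    obtain ⟨y, hxy, z, hyz, hzx⟩ := (conn₄_layer_two_iff x).1 hx
    exact (conn₄_layer_two_iff _).2 ⟨σ y, (hσ _ _).2 hxy, σ z, (hσ _ _).2 hyz, (hσ _ _).2 hzx⟩
  have cases : ∀ i j : ZMod 4, (i = 0 → j = 0) → (i = 1 → j = 1) → (i ≠ 2 → j ≠ 2) →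
      (j = 0 → i = 0) → (j = 1 → i = 1) → (j ≠ 2 → i ≠ 2) → j = i := by decide
  refine cases _ _ (zero σ hσ x) (one σ hσ x) (two σ hσ x) (fun h => ?_) (fun h => ?_)
    (fun h => ?_)
  · simpa using zero _ hσ.symm _ h
  · simpa using one _ hσ.symm _ h
  · simpa using two _ hσ.symm _ h

set_option synthInstance.maxHeartbeats 200000 in
set_option synthInstance.maxSize 1000 in
theorem hasOmSRValencyTwo_four : HasOmSRValencyTwo Klein 4 := by
  refine hasOmSRValencyTwo_of conn₄ (by decide +kernel) (by decide +kernel) (by decide +kernel)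
    fun σ hσ => ?_
  have hlayer := conn₄_layer hσ
  have h₃ (g) : (σ (g, 3)).1 = (σ (g, 0)).1 := by
    simpa using (hσ.fst_apply_mul hlayer (i := 3) (j := 0) (t := 1) (by decide) g).symm
  have h₂ (g) : (σ (g, 2)).1 = (σ (g, 0)).1 := by
    simpa [h₃] using (hσ.fst_apply_mul hlayer (i := 2) (j := 3) (t := 1) (by decide) g).symm
  have h₁ (g) : (σ (g, 1)).1 = (σ (g, 0)).1 := by
    simpa [h₂] using (hσ.fst_apply_mul hlayer (i := 1) (j := 2) (t := 1) (by decide) g).symm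
  refine eq_rightTransl_of_layers hlayer (fun g i => ?_) (fun g => ?_) (fun g => ?_)
  · have : ∀ i : ZMod 4, i = 0 ∨ i = 1 ∨ i = 2 ∨ i = 3 := by decide
    rcases this i with rfl | rfl | rfl | rfl
    exacts [rfl, h₁ g, h₂ g, h₃ g]
  · simpa only [h₂, h₃] using hσ.fst_apply_mul hlayer (i := 3) (j := 2) (t := a) (by decide) g
  · simpa only [h₂] using hσ.fst_apply_mul hlayer (i := 2) (j := 0) (t := b) (by decide) g

end Four

section Large

/-- Connection sets for `m ≥ 5`, described through the representatives in `{0, …, m - 1}`. -/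
def ladderMem (m k l : ℕ) (t : Klein) : Prop :=
  (l = k + 1 ∧ t = 1) ∨ (k = 0 ∧ l = 1 ∧ t = a) ∨ (k = 1 ∧ l = 0 ∧ t = b) ∨
    (k = 2 ∧ l + 1 = m ∧ t = 1) ∨ (3 ≤ k ∧ l + 1 = k ∧ t = a) ∨ (k + 1 = m ∧ l = 0 ∧ t = 1)

/-- Connection sets for `m ≥ 5`. -/
def ladderConn (m : ℕ) (i j : ZMod m) : Set Klein :=
  {t | ladderMem m i.val j.val t}

theorem ladderMem_out {m k : ℕ} (hm : 5 ≤ m) (hk : k < m) :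
    ∃ t u : Klein, ∃ l n : ℕ, l < m ∧ n < m ∧ (t ≠ u ∨ l ≠ n) ∧ ∀ s j, j < m →
      (ladderMem m k j s ↔ (s = t ∧ j = l) ∨ (s = u ∧ j = n)) := by
  have ha := a_ne_one
  obtain h | h | h | h | h : k = 0 ∨ k = 1 ∨ k = 2 ∨ (3 ≤ k ∧ k + 1 < m) ∨ k + 1 = m := by omega
  · exact ⟨1, a, 1, 1, by omega, by omega, by grind, by grind [ladderMem]⟩
  · exact ⟨1, b, 2, 0, by omega, by omega, by grind, by grind [ladderMem]⟩
  · exact ⟨1, 1, 3, m - 1, by omega, by omega, by grind, by grind [ladderMem]⟩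
  · exact ⟨1, a, k + 1, k - 1, by omega, by omega, by grind, by grind [ladderMem]⟩
  · exact ⟨1, a, 0, k - 1, by omega, by omega, by grind, by grind [ladderMem]⟩

theorem ladderMem_in {m k : ℕ} (hm : 5 ≤ m) (hk : k < m) :
    ∃ t u : Klein, ∃ l n : ℕ, l < m ∧ n < m ∧ (t ≠ u ∨ l ≠ n) ∧ ∀ s j, j < m →
      (ladderMem m j k s ↔ (s = t ∧ j = l) ∨ (s = u ∧ j = n)) := by
  have ha := a_ne_one
  obtain h | h | h | h : k = 0 ∨ k = 1 ∨ (2 ≤ k ∧ k + 1 < m) ∨ k + 1 = m := by omega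
  · exact ⟨1, b, m - 1, 1, by omega, by omega, by grind, by grind [ladderMem]⟩
  · exact ⟨1, a, 0, 0, by omega, by omega, by grind, by grind [ladderMem]⟩
  · exact ⟨1, a, k - 1, k + 1, by omega, by omega, by grind, by grind [ladderMem]⟩
  · exact ⟨1, 1, k - 1, 2, by omega, by omega, by grind, by grind [ladderMem]⟩

theorem ladderMem_unique {m k l : ℕ} {t u : Klein} (hm : 5 ≤ m) (hk : k ≠ 0)
    (ht : ladderMem m k l t) (hu : ladderMem m k l u) : t = u := by
  unfold ladderMem at ht hu
  grind

/-- Two vertices outside the layer `0` with the same out-neighbours, in the layers `l ≠ n`,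
coincide. -/
theorem ladderMem_separates {m k k' l n : ℕ} {t u t' u' : Klein} (hm : 5 ≤ m) (hk : k < m)
    (hk' : k' < m) (hln : l ≠ n) (ht : ladderMem m k l t) (hu : ladderMem m k n u)
    (ht' : ladderMem m k' l t') (hu' : ladderMem m k' n u') (h : t * u = t' * u') :
    k' = k ∧ t' = t := by
  have ha := a_ne_one
  have hb := b_ne_one
  have hab := a_ne_b
  unfold ladderMem at ht hu ht' hu'
  rcases ht with ht | ht | ht | ht | ht | ht <;> rcases hu with hu | hu | hu | hu | hu | hu <;>
  first
  | (exfalso; omega)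
  | (rcases ht' with ht' | ht' | ht' | ht' | ht' | ht' <;>
      rcases hu' with hu' | hu' | hu' | hu' | hu' | hu' <;>
      first
      | (exfalso; omega)
      | (simp_all; done)
      | (simp_all; omega))

variable {m : ℕ}

theorem ladderConn_arc {x y : Klein × ZMod m} (h : mCayleyArc (ladderConn m) x y) :
    ∃ t, ladderMem m x.2.val y.2.val t ∧ y.1 = t * x.1 := h

theorem ladderConn_exists_out (x : Klein × ZMod m) {l : ℕ} {t : Klein} (hl : l < m)
    (h : ladderMem m x.2.val l t) :
    ∃ y : Klein × ZMod m, y.1 = t * x.1 ∧ y.2.val = l ∧ mCayleyArc (ladderConn m) x y := by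
  have hv := ZMod.val_natCast_of_lt hl
  exact ⟨(t * x.1, (l : ZMod m)), rfl, hv, t, by simpa [ladderConn, hv] using h, rfl⟩

theorem ladderConn_exists_in (x : Klein × ZMod m) {l : ℕ} {t : Klein} (hl : l < m)
    (h : ladderMem m l x.2.val t) :
    ∃ y : Klein × ZMod m, y.2.val = l ∧ mCayleyArc (ladderConn m) y x := by
  have hv := ZMod.val_natCast_of_lt hl
  exact ⟨(t⁻¹ * x.1, (l : ZMod m)), hv, t, by simpa [ladderConn, hv] using h, by simp⟩

/-- The layer `0` consists of the vertices sharing all their out-neighbours with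
another vertex. -/
theorem ladderConn_layer_zero_iff (hm : 5 ≤ m) (x : Klein × ZMod m) : x.2.val = 0 ↔
    ∃ y, y ≠ x ∧ ∀ z, mCayleyArc (ladderConn m) x z → mCayleyArc (ladderConn m) y z := by
  have : NeZero m := ⟨by omega⟩
  have ha := a_ne_one
  have haa : a * a = 1 := by decide
  constructor
  · intro hx
    refine ⟨(a * x.1, x.2), by simpa [Prod.ext_iff] using ha, ?_⟩
    rintro z ⟨t, ht, hz⟩
    refine ⟨a * t, ?_, ?_⟩
    · change ladderMem m x.2.val z.2.val t at ht
      change ladderMem m x.2.val z.2.val (a * t)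
      obtain ⟨hv, rfl | rfl⟩ : z.2.val = 1 ∧ (t = 1 ∨ t = a) := by grind [ladderMem]
      · simp [ladderMem, hx, hv]
      · simp [ladderMem, hx, hv, haa]
    · rw [hz, mul_mul_mul_comm, haa, one_mul]
  · rintro ⟨y, hne, h⟩
    by_contra hx
    have hxm := ZMod.val_lt x.2
    have hym := ZMod.val_lt y.2
    obtain ⟨t, u, l, n, hl, hn, htu, hmem⟩ := ladderMem_out hm hxm
    obtain ⟨p, hp, hpl, hxp⟩ := ladderConn_exists_out x hl ((hmem t l hl).2 (by simp))
    obtain ⟨q, hq, hqn, hxq⟩ := ladderConn_exists_out x hn ((hmem u n hn).2 (by simp))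
    obtain ⟨t', ht', hyp⟩ := ladderConn_arc (h p hxp)
    obtain ⟨u', hu', hyq⟩ := ladderConn_arc (h q hxq)
    have hln : l ≠ n := by
      rintro rfl
      have htu : t ≠ u := by simpa using htu
      exact htu (ladderMem_unique hm hx ((hmem t l hl).2 (by simp))
        ((hmem u l hl).2 (by simp)))
    rw [hpl] at ht'
    rw [hqn] at hu'
    rw [hp] at hyp
    rw [hq] at hyq
    have htu' : t * u = t' * u' := by
      have h₁ : ∀ x y t u t' u' : Klein, t * x = t' * y → u * x = u' * y → t * u = t' * u' := by
        intro x y t u t' u' h₁ h₂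
        have h₃ : t * u * (x * x) = t' * u' * (y * y) := by
          rw [mul_mul_mul_comm, h₁, h₂, mul_mul_mul_comm]
        have sq : ∀ x : Klein, x * x = 1 := by decide
        simpa [sq] using h₃
      exact h₁ _ _ _ _ _ _ hyp hyq
    obtain ⟨hv, rfl⟩ := ladderMem_separates hm hxm hym hln ((hmem t l hl).2 (by simp))
      ((hmem u n hn).2 (by simp)) ht' hu' htu'
    exact hne (Prod.ext (mul_left_cancel hyp).symm (ZMod.val_injective m hv))

theorem ladderConn_layer (hm : 5 ≤ m) (k : ℕ) : ∀ σ : Equiv.Perm (Klein × ZMod m),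
    IsDigraphAuto (mCayleyArc (ladderConn m)) σ → ∀ x, x.2.val = k → (σ x).2.val = k := by
  have : NeZero m := ⟨by omega⟩
  have back {l : ℕ} (h : ∀ σ : Equiv.Perm (Klein × ZMod m),
      IsDigraphAuto (mCayleyArc (ladderConn m)) σ → ∀ x, x.2.val = l → (σ x).2.val = l)
      {σ : Equiv.Perm (Klein × ZMod m)} (hσ : IsDigraphAuto (mCayleyArc (ladderConn m)) σ)
      {x : Klein × ZMod m} (hx : (σ x).2.val = l) : x.2.val = l := by
    simpa using h _ hσ.symm _ hx
  have zero : ∀ σ : Equiv.Perm (Klein × ZMod m),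
      IsDigraphAuto (mCayleyArc (ladderConn m)) σ → ∀ x, x.2.val = 0 → (σ x).2.val = 0 := by
    intro σ hσ x hx
    obtain ⟨y, hne, hy⟩ := (ladderConn_layer_zero_iff hm x).1 hx
    refine (ladderConn_layer_zero_iff hm _).2 ⟨σ y, σ.injective.ne hne, fun z hz => ?_⟩
    obtain ⟨z, rfl⟩ := σ.surjective z
    exact (hσ _ _).2 (hy z ((hσ _ _).1 hz))
  have one : ∀ σ : Equiv.Perm (Klein × ZMod m),
      IsDigraphAuto (mCayleyArc (ladderConn m)) σ → ∀ x, x.2.val = 1 → (σ x).2.val = 1 := by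
    intro σ hσ x hx
    obtain ⟨y, hy, hyx⟩ := ladderConn_exists_in x (l := 0) (t := 1) (by omega)
      (by simp [ladderMem, hx])
    obtain ⟨t, ht, -⟩ := ladderConn_arc ((hσ _ _).2 hyx)
    have := zero σ hσ y hy
    grind [ladderMem]
  have last : ∀ σ : Equiv.Perm (Klein × ZMod m),
      IsDigraphAuto (mCayleyArc (ladderConn m)) σ → ∀ x, x.2.val = m - 1 →
        (σ x).2.val = m - 1 := by
    intro σ hσ x hx
    obtain ⟨y, -, hy, hxy⟩ := ladderConn_exists_out x (l := 0) (t := 1) (by omega)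
      (by simp [ladderMem]; omega)
    obtain ⟨t, ht, -⟩ := ladderConn_arc ((hσ _ _).2 hxy)
    have := zero σ hσ y hy
    have := back one hσ (x := x)
    grind [ladderMem]
  induction k using Nat.strong_induction_on with
  | _ k ih =>
    intro σ hσ x hx
    have hxm := ZMod.val_lt x.2
    have hσm := ZMod.val_lt (σ x).2
    obtain h | h | h | h : k = 0 ∨ k = 1 ∨ k = m - 1 ∨ (2 ≤ k ∧ k + 1 < m) := by omega
    · subst h; exact zero σ hσ x hx
    · subst h; exact one σ hσ x hx
    · subst h; exact last σ hσ x hx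
    · obtain ⟨y, hy, hyx⟩ := ladderConn_exists_in x (l := k - 1) (t := 1) (by omega)
        (by simp [ladderMem]; omega)
      obtain ⟨t, ht, -⟩ := ladderConn_arc ((hσ _ _).2 hyx)
      have h₁ := ih (k - 1) (by omega) σ hσ y hy
      have h₂ := back (ih (k - 2) (by omega)) hσ (x := x)
      have h₃ := back last hσ (x := x)
      unfold ladderMem at ht
      omega

theorem hasOmSRValencyTwo_large (hm : 5 ≤ m) : HasOmSRValencyTwo Klein m := by
  have : NeZero m := ⟨by omega⟩
  have ha := a_ne_one
  have hb := b_ne_one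
  have hab := a_ne_b
  have lift (Q : Klein → ℕ → Prop) (h : ∃ t u : Klein, ∃ l n : ℕ, l < m ∧ n < m ∧
      (t ≠ u ∨ l ≠ n) ∧ ∀ s j, j < m → (Q s j ↔ (s = t ∧ j = l) ∨ (s = u ∧ j = n))) :
      ∃ p q : Klein × ZMod m, p ≠ q ∧ ∀ r : Klein × ZMod m, Q r.1 r.2.val ↔ r = p ∨ r = q := by
    obtain ⟨t, u, l, n, hl, hn, hne, h⟩ := h
    have eq_iff (j : ZMod m) {l : ℕ} (hl : l < m) : j = (l : ZMod m) ↔ j.val = l := by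
      rw [← (ZMod.val_injective m).eq_iff, ZMod.val_natCast_of_lt hl]
    refine ⟨(t, l), (u, n), ?_, fun r => ?_⟩
    · rw [Ne, Prod.ext_iff, eq_iff _ hn, ZMod.val_natCast_of_lt hl]
      tauto
    · rw [h _ _ (ZMod.val_lt _), Prod.ext_iff, Prod.ext_iff, eq_iff _ hl, eq_iff _ hn]
  refine hasOmSRValencyTwo_of (ladderConn m) (fun i j t h₁ h₂ => ?_)
    (fun i => lift (fun t l => ladderMem m i.val l t) (ladderMem_out hm (ZMod.val_lt i)))
    (fun j => lift (fun t k => ladderMem m k j.val t) (ladderMem_in hm (ZMod.val_lt j)))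
    fun σ hσ => ?_
  · change ladderMem m _ _ t at h₁ h₂
    grind [ladderMem]
  have hlayer (x) : (σ x).2 = x.2 := ZMod.val_injective m (ladderConn_layer hm _ σ hσ x rfl)
  have arc {k l : ℕ} {t : Klein} (hk : k < m) (hl : l < m)
      (h : ∀ s, ladderMem m k l s ↔ s = t) (g : Klein) :
      (σ (t * g, (l : ZMod m))).1 = t * (σ (g, (k : ZMod m))).1 := by
    refine hσ.fst_apply_mul hlayer (fun s => ?_) g
    rw [← h s, ladderConn, Set.mem_ofPred_eq, ZMod.val_natCast_of_lt hk, ZMod.val_natCast_of_lt hl]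
  have hfirst (g) : (σ (g, ((m - 1 : ℕ) : ZMod m))).1 = (σ (g, 0)).1 := by
    simpa using (arc (k := m - 1) (l := 0) (t := 1) (by omega) (by omega)
      (by grind [ladderMem]) g).symm
  have hstep (k : ℕ) (hk : 1 ≤ k) (hkm : k < m) (g) :
      (σ (g, (k : ZMod m))).1 = (σ (g, ((1 : ℕ) : ZMod m))).1 := by
    induction k, hk using Nat.le_induction with
    | base => rfl
    | succ k hk ih =>
      rw [← ih (by omega)]
      simpa only [one_mul] using arc (k := k) (l := k + 1) (t := 1) (by omega) hkm
        (by grind [ladderMem]) g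
  have hconst (k : ℕ) (hkm : k < m) (g) : (σ (g, (k : ZMod m))).1 = (σ (g, 0)).1 := by
    rcases Nat.eq_zero_or_pos k with rfl | hk
    · simp
    · rw [hstep k hk hkm, ← hfirst, hstep (m - 1) (by omega) (by omega)]
  refine eq_rightTransl_of_layers hlayer (fun g i => ?_) (fun g => ?_) (fun g => ?_)
  · simpa using hconst i.val (ZMod.val_lt i) g
  · have := arc (k := 3) (l := 2) (t := a) (by omega) (by omega) (by grind [ladderMem]) g
    rwa [hconst 3 (by omega), hconst 2 (by omega)] at this
  · have := arc (k := 1) (l := 0) (t := b) (by omega) (by omega) (by grind [ladderMem]) g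
    rwa [hconst 1 (by omega), hconst 0 (by omega)] at this

end Large

section Small

theorem not_mem_conn_self {m : ℕ} {T : ZMod m → ZMod m → Set Klein}
    (hor : IsOrientedRel (mCayleyArc T)) {i j : ZMod m} {t : Klein} (h : t ∈ T i j) :
    t ∉ T j i := by
  intro h'
  refine hor (1, i) (t, j) ⟨t, h, by simp⟩ ⟨t, h', ?_⟩
  exact (by decide : ∀ t : Klein, 1 = t * t) t

theorem not_hasOmSRValencyTwo_one : ¬ HasOmSRValencyTwo Klein 1 := by
  rintro ⟨T, hor, hout, -, -⟩
  have h := hout (1, 0)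
  obtain ⟨y, z, -, hyz⟩ := Set.ncard_eq_two.1 h
  have hy : mCayleyArc T (1, 0) y := by
    have : y ∈ {y | mCayleyArc T (1, 0) y} := by simp [hyz]
    exact this
  obtain ⟨t, ht, -⟩ := hy
  have h0 : y.2 = 0 := Subsingleton.elim (α := Fin 1) _ _
  rw [h0] at ht
  exact not_mem_conn_self hor ht ht

/-- The arcs of an oriented bi-Cayley digraph of valency two on the Klein four-group. -/
def biArc (p q : Klein) (x y : Klein × ZMod 2) : Prop :=
  (x.2 = 0 ∧ y.2 = 1 ∧ (y.1 * x.1⁻¹ = p ∨ y.1 * x.1⁻¹ = q)) ∨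
    (x.2 = 1 ∧ y.2 = 0 ∧ y.1 * x.1⁻¹ ≠ p ∧ y.1 * x.1⁻¹ ≠ q)

instance (p q : Klein) : DecidableRel (biArc p q) := fun x y => by
  unfold biArc
  infer_instance

theorem isDigraphAuto_swap_biArc : ∀ p q : Klein, p ≠ q → ∀ x y : Klein × ZMod 2,
    biArc p q (Equiv.swap (p, 1) (q, 1) x) (Equiv.swap (p, 1) (q, 1) y) ↔ biArc p q x y := by
  decide +kernel

theorem exists_pair_of_ncard_out {T : ZMod 2 → ZMod 2 → Set Klein}
    (hor : IsOrientedRel (mCayleyArc T)) {i j : ZMod 2} (hij : i ≠ j)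
    (hout : {y | mCayleyArc T (1, i) y}.ncard = 2) :
    ∃ p q : Klein, p ≠ q ∧ ∀ t, t ∈ T i j ↔ t = p ∨ t = q := by
  obtain ⟨⟨p, k⟩, ⟨q, l⟩, hne, h⟩ := Set.ncard_eq_two.1 hout
  have key (y : Klein × ZMod 2) : y.1 ∈ T i y.2 ↔ y = (p, k) ∨ y = (q, l) := by
    have := Set.ext_iff.1 h y
    simpa [mCayleyArc_iff] using this
  have hT {t : Klein} {k : ZMod 2} (ht : t ∈ T i k) : k = j := by
    have two : ∀ i j k : ZMod 2, i ≠ j → k ≠ i → k = j := by decide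
    refine two i j k hij ?_
    rintro rfl
    exact not_mem_conn_self hor ht ht
  obtain rfl := hT ((key (p, k)).2 (.inl rfl))
  obtain rfl := hT ((key (q, l)).2 (.inr rfl))
  exact ⟨p, q, by simpa using hne, fun t => by simpa using key (t, l)⟩

set_option synthInstance.maxHeartbeats 200000 in
set_option synthInstance.maxSize 1000 in
theorem not_hasOmSRValencyTwo_two : ¬ HasOmSRValencyTwo Klein 2 := by
  rintro ⟨T, hor, hout, -, haut⟩
  obtain ⟨p, q, hpq, hT⟩ := exists_pair_of_ncard_out hor (i := 0) (j := 1) (by decide) (hout _)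
  obtain ⟨r, s, hrs, hT'⟩ := exists_pair_of_ncard_out hor (i := 1) (j := 0) (by decide) (hout _)
  have hr := not_mem_conn_self hor ((hT' r).2 (.inl rfl))
  have hs := not_mem_conn_self hor ((hT' s).2 (.inr rfl))
  have compl : ∀ p q r s : Klein, p ≠ q → r ≠ s → ¬ (r = p ∨ r = q) → ¬ (s = p ∨ s = q) →
      ∀ t, (t = r ∨ t = s ↔ t ≠ p ∧ t ≠ q) := by decide +kernel
  rw [hT] at hr hs
  have hcompl := compl p q r s hpq hrs hr hs
  have harc (x y : Klein × ZMod 2) : mCayleyArc T x y ↔ biArc p q x y := by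
    obtain ⟨g, i⟩ := x
    obtain ⟨h, j⟩ := y
    have two : ∀ i : ZMod 2, i = 0 ∨ i = 1 := by decide
    have hself (i : ZMod 2) (t : Klein) : t ∉ T i i := fun h => not_mem_conn_self hor h h
    rw [mCayleyArc_iff]
    rcases two i with rfl | rfl <;> rcases two j with rfl | rfl <;>
      simp [biArc, hself, hT, hT', hcompl]
  obtain ⟨h, hh⟩ := (haut (Equiv.swap (p, 1) (q, 1))).1 fun x y => by
    rw [harc, harc, isDigraphAuto_swap_biArc p q hpq]
  have h₀ := congrArg Prod.fst (Equiv.ext_iff.1 hh (1, 0))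
  have h₁ := congrArg Prod.fst (Equiv.ext_iff.1 hh (p, 1))
  rw [Equiv.swap_apply_of_ne_of_ne (by simp) (by simp)] at h₀
  rw [Equiv.swap_apply_left] at h₁
  simp [rightTransl] at h₀ h₁
  simp [← h₀] at h₁
  exact hpq h₁.symm

end Small

/-- The elementary abelian group `Z_2 × Z_2` admits an OmSR of valency two iff
`m ≥ 3`. -/
theorem z2z2_omsr_valency_two (m : ℕ) (hm : 1 ≤ m) :
    HasOmSRValencyTwo (Multiplicative (ZMod 2 × ZMod 2)) m ↔ 3 ≤ m := by
  constructor
  · intro h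
    by_contra hlt
    obtain rfl | rfl : m = 1 ∨ m = 2 := by omega
    · exact not_hasOmSRValencyTwo_one h
    · exact not_hasOmSRValencyTwo_two h
  · intro h
    obtain rfl | rfl | h : m = 3 ∨ m = 4 ∨ 5 ≤ m := by omega
    · exact hasOmSRValencyTwo_three
    · exact hasOmSRValencyTwo_four
    · exact hasOmSRValencyTwo_large h
end

section
/- Every finite cyclic group of order at least 3 admits an oriented m-semiregular representation (OmSR) of valency two for every integer m ≥ 2. -/
section Helical

variable {G : Type*} [Group G] {m : ℕ}

/-- Connection sets joining `(g,i)` to `(e i * g, i)` and to `(f i * g, i + 1)`. -/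
def helicalSets (e f : ZMod m → G) (i j : ZMod m) : Set G :=
  {t | (j = i ∧ t = e i) ∨ (j = i + 1 ∧ t = f i)}

theorem helical_arc_iff (e f : ZMod m → G) (x y : G × ZMod m) :
    mCayleyArc (helicalSets e f) x y ↔
      y = (e x.2 * x.1, x.2) ∨ y = (f x.2 * x.1, x.2 + 1) := by
  obtain ⟨g, i⟩ := x
  obtain ⟨k, j⟩ := y
  simp only [mCayleyArc, helicalSets, Set.mem_ofPred_eq, Prod.mk.injEq]
  constructor
  · rintro ⟨t, ⟨rfl, rfl⟩ | ⟨rfl, rfl⟩, rfl⟩ <;> simp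
  · rintro (⟨rfl, rfl⟩ | ⟨rfl, rfl⟩)
    · exact ⟨e j, by simp, rfl⟩
    · exact ⟨f i, by simp, rfl⟩

theorem helical_out_ncard [Nontrivial (ZMod m)] (e f : ZMod m → G) (x : G × ZMod m) :
    {y | mCayleyArc (helicalSets e f) x y}.ncard = 2 := by
  rw [Set.ncard_eq_two]
  refine ⟨(e x.2 * x.1, x.2), (f x.2 * x.1, x.2 + 1), by simp, ?_⟩
  ext y
  simp [helical_arc_iff]

theorem helical_in_ncard [Nontrivial (ZMod m)] (e f : ZMod m → G) (x : G × ZMod m) :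
    {y | mCayleyArc (helicalSets e f) y x}.ncard = 2 := by
  obtain ⟨g, i⟩ := x
  rw [Set.ncard_eq_two]
  refine ⟨((e i)⁻¹ * g, i), ((f (i - 1))⁻¹ * g, i - 1), by simp [eq_sub_iff_add_eq], ?_⟩
  ext ⟨k, j⟩
  simp only [helical_arc_iff, Set.mem_ofPred_eq, Set.mem_insert_iff, Set.mem_singleton_iff,
    Prod.mk.injEq]
  constructor
  · rintro (⟨rfl, rfl⟩ | ⟨rfl, rfl⟩) <;> simp
  · rintro (⟨rfl, rfl⟩ | ⟨rfl, rfl⟩) <;> simp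

theorem helical_oriented [Nontrivial (ZMod m)] (e f : ZMod m → G)
    (he : ∀ i, e i * e i ≠ 1) (hf : ∀ i, i + 1 + 1 = i → f (i + 1) * f i ≠ 1) :
    IsOrientedRel (mCayleyArc (helicalSets e f)) := by
  rintro ⟨g, i⟩ y hxy hyx
  rw [helical_arc_iff] at hxy hyx
  rcases hxy with rfl | rfl <;> simp only [Prod.mk.injEq] at hyx <;>
    rcases hyx with ⟨h1, h2⟩ | ⟨h1, h2⟩
  · rw [← mul_assoc, eq_comm, mul_eq_right] at h1
    exact he i h1
  · simp at h2
  · simp at h2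
  · rw [← mul_assoc, eq_comm, mul_eq_right] at h1
    exact hf i h2.symm h1

theorem rightTransl_isDigraphAuto (T : ZMod m → ZMod m → Set G) (h : G) :
    IsDigraphAuto (mCayleyArc T) (rightTransl m h) := by
  intro x y
  simp [mCayleyArc, rightTransl, ← mul_assoc]

/-- An automorphism stabilising the level `0`, whose self-connection generates `G`, is a
right translation. -/
theorem helical_auto_eq_rightTransl [Finite G] [NeZero m] [Nontrivial (ZMod m)] (e f : ZMod m → G)
    (hgen : ∀ g : G, g ∈ Subgroup.zpowers (e 0)) {σ : Equiv.Perm (G × ZMod m)}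
    (hσ : IsDigraphAuto (mCayleyArc (helicalSets e f)) σ)
    (h0 : ∀ g, (σ (g, 0)).2 = 0) : ∃ h : G, σ = rightTransl m h := by
  have hout : ∀ x y, (y = (e x.2 * x.1, x.2) ∨ y = (f x.2 * x.1, x.2 + 1)) →
      (σ y = (e (σ x).2 * (σ x).1, (σ x).2) ∨ σ y = (f (σ x).2 * (σ x).1, (σ x).2 + 1)) := by
    intro x y hxy
    rw [← helical_arc_iff] at hxy ⊢
    exact (hσ x y).2 hxy
  have hself : ∀ g, σ (e 0 * g, 0) = (e 0 * (σ (g, 0)).1, 0) := by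
    intro g
    have hg := h0 g
    have hg' := h0 (e 0 * g)
    rcases hout (g, 0) (e 0 * g, 0) (Or.inl rfl) with h | h
    · rw [h, hg]
    · rw [h, hg] at hg'
      simp at hg'
  obtain ⟨h, hh⟩ : ∃ h, σ (1, 0) = (h, 0) := ⟨(σ (1, 0)).1, Prod.ext rfl (h0 1)⟩
  have hpow : ∀ k : ℕ, σ (e 0 ^ k, 0) = (e 0 ^ k * h, 0) := by
    intro k
    induction k with
    | zero => simpa using hh
    | succ k ih => rw [pow_succ', hself, ih, mul_assoc]
  have hlevel : ∀ k : ℕ, ∀ g, σ (g, (k : ZMod m)) = (g * h, (k : ZMod m)) := by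
    intro k
    induction k with
    | zero =>
      intro g
      obtain ⟨n, rfl⟩ := (mem_powers_iff_mem_zpowers).2 (hgen g)
      simpa using hpow n
    | succ k ih =>
      intro g
      have hx := ih ((f k)⁻¹ * g)
      rcases hout ((f k)⁻¹ * g, (k : ZMod m)) (g, (k : ZMod m) + 1)
        (Or.inr (by simp)) with hy | hy
      · rw [hx] at hy
        have hz := ih (e k * ((f k)⁻¹ * g))
        rw [mul_assoc] at hz
        have := σ.injective (hy.trans hz.symm)
        simp at this
      · rw [hx] at hy
        push_cast
        simpa [mul_assoc] using hy
  refine ⟨h, Equiv.ext fun x => ?_⟩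
  obtain ⟨g, i⟩ := x
  obtain ⟨k, rfl⟩ : ∃ k : ℕ, (k : ZMod m) = i := ZMod.natCast_zmod_surjective i
  simp [hlevel, rightTransl]

/-- A vertex has the diamond property if two of its out-neighbours share an out-neighbour. -/
def IsDiamondSource {V : Type*} (A : V → V → Prop) (x : V) : Prop :=
  ∃ y z w, y ≠ z ∧ A x y ∧ A x z ∧ A y w ∧ A z w

/-- Every arc leaving the vertex lies on a directed triangle. -/
def IsTriangular {V : Type*} (A : V → V → Prop) (x : V) : Prop :=
  ∀ y, A x y → ∃ z, A y z ∧ A z x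

theorem IsDigraphAuto.isDiamondSource_iff {V : Type*} {A : V → V → Prop} {σ : Equiv.Perm V}
    (hσ : IsDigraphAuto A σ) (x : V) : IsDiamondSource A (σ x) ↔ IsDiamondSource A x := by
  constructor
  · rintro ⟨y, z, w, h⟩
    obtain ⟨y, rfl⟩ := σ.surjective y
    obtain ⟨z, rfl⟩ := σ.surjective z
    obtain ⟨w, rfl⟩ := σ.surjective w
    rw [hσ, hσ, hσ, hσ, σ.injective.ne_iff] at h
    exact ⟨y, z, w, h⟩
  · rintro ⟨y, z, w, h⟩
    refine ⟨σ y, σ z, σ w, ?_⟩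
    rwa [hσ, hσ, hσ, hσ, σ.injective.ne_iff]

theorem IsDigraphAuto.isTriangular_iff {V : Type*} {A : V → V → Prop} {σ : Equiv.Perm V}
    (hσ : IsDigraphAuto A σ) (x : V) : IsTriangular A (σ x) ↔ IsTriangular A x := by
  constructor
  · intro h y hy
    obtain ⟨z, hz⟩ := h (σ y) ((hσ x y).2 hy)
    obtain ⟨z, rfl⟩ := σ.surjective z
    rw [hσ, hσ] at hz
    exact ⟨z, hz⟩
  · intro h y hy
    obtain ⟨y, rfl⟩ := σ.surjective y
    obtain ⟨z, hz⟩ := h y ((hσ x y).1 hy)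
    refine ⟨σ z, ?_⟩
    rwa [hσ, hσ]

theorem helical_isDiamondSource_iff (e f : ZMod m → G) [Nontrivial (ZMod m)]
    (x : G × ZMod m) : IsDiamondSource (mCayleyArc (helicalSets e f)) x ↔
      f x.2 * e x.2 = e (x.2 + 1) * f x.2 ∨
        (x.2 + 1 + 1 = x.2 ∧ e x.2 * e x.2 = f (x.2 + 1) * f x.2) := by
  obtain ⟨g, i⟩ := x
  simp only [IsDiamondSource, helical_arc_iff]
  constructor
  · rintro ⟨y, z, w, hyz, rfl | rfl, rfl | rfl, hy, hz⟩
    · exact absurd rfl hyz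
    · rcases hy with rfl | rfl <;> simp [← mul_assoc] at hz
      · exact Or.inr ⟨hz.2.symm, hz.1⟩
      · exact Or.inl hz
    · rcases hz with rfl | rfl <;> simp [← mul_assoc] at hy
      · exact Or.inr ⟨hy.2.symm, hy.1⟩
      · exact Or.inl hy
    · exact absurd rfl hyz
  · rintro (h | ⟨h1, h2⟩)
    · refine ⟨(e i * g, i), (f i * g, i + 1), (f i * (e i * g), i + 1), by simp,
        Or.inl rfl, Or.inr rfl, Or.inr rfl, Or.inl ?_⟩
      simp [← mul_assoc, h]
    · refine ⟨(e i * g, i), (f i * g, i + 1), (e i * (e i * g), i), by simp,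
        Or.inl rfl, Or.inr rfl, Or.inl rfl, Or.inr ?_⟩
      simp [← mul_assoc, h1, h2]

theorem hasOmSRValencyTwo_of_helical [Finite G] [NeZero m] [Nontrivial (ZMod m)] (e f : ZMod m → G)
    (he : ∀ i, e i * e i ≠ 1) (hf : ∀ i, i + 1 + 1 = i → f (i + 1) * f i ≠ 1)
    (hgen : ∀ g : G, g ∈ Subgroup.zpowers (e 0))
    (h0 : ∀ σ : Equiv.Perm (G × ZMod m), IsDigraphAuto (mCayleyArc (helicalSets e f)) σ →
      ∀ g, (σ (g, 0)).2 = 0) : HasOmSRValencyTwo G m := by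
  refine ⟨helicalSets e f, helical_oriented e f he hf, helical_out_ncard e f,
    helical_in_ncard e f, fun σ => ⟨fun hσ =>
      helical_auto_eq_rightTransl e f hgen hσ (h0 σ hσ), ?_⟩⟩
  rintro ⟨h, rfl⟩
  exact rightTransl_isDigraphAuto _ h

theorem hasOmSRValencyTwo_of_three_le [Finite G] {a : G}
    (ha : ∀ g : G, g ∈ Subgroup.zpowers a) (ha2 : a * a ≠ 1) (hm : 3 ≤ m) :
    HasOmSRValencyTwo G m := by
  have : Fact (1 < m) := ⟨by omega⟩
  have : NeZero m := ⟨by omega⟩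
  have h2 : (1 : ZMod m) + 1 ≠ 0 := by
    intro h
    have h' : ((2 : ℕ) : ZMod m) = 0 := by
      push_cast
      rw [← h]
      norm_num
    rw [ZMod.natCast_eq_zero_iff] at h'
    exact absurd (Nat.le_of_dvd two_pos h') (by omega)
  have hinv : a⁻¹ ≠ a := fun h => ha2 (by rw [← mul_inv_cancel a, h])
  have hshift : ∀ i : ZMod m, i + 1 + 1 ≠ i := fun i h => h2 (by simpa [add_assoc] using h)
  let e : ZMod m → G := fun i => if i = 0 then a⁻¹ else a
  let f : ZMod m → G := fun _ => 1
  have hdiamond : ∀ x, IsDiamondSource (mCayleyArc (helicalSets e f)) x ↔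
      x.2 ≠ 0 ∧ x.2 + 1 ≠ 0 := by
    intro x
    rw [helical_isDiamondSource_iff]
    simp only [hshift, false_and, or_false, e, f, one_mul, mul_one]
    by_cases hi : x.2 = 0
    · simp [hi, hinv]
    · by_cases hi' : x.2 + 1 = 0 <;> simp [hi, hi', hinv.symm]
  refine hasOmSRValencyTwo_of_helical e f (fun i => ?_) (fun i h => absurd h (hshift i))
    (fun g => by simpa [e] using ha g) fun σ hσ g => ?_
  · by_cases hi : i = 0
    · simp only [e, hi, if_true, ne_eq, ← mul_inv_rev, inv_eq_one]
      exact ha2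
    · simpa [e, hi] using ha2
  · by_contra hne
    have hx := hσ.isDiamondSource_iff (g, 0)
    have hy := hσ.isDiamondSource_iff (g, 1)
    simp only [hdiamond] at hx hy
    have harc := (hσ (g, 0) (g, 1)).2 ((helical_arc_iff e f _ _).2 (Or.inr (by simp [f])))
    have hlast : (σ (g, 0)).2 + 1 = 0 := by
      by_contra hne'
      exact (hx.1 ⟨hne, hne'⟩).1 rfl
    have hone := hy.2 ⟨one_ne_zero, h2⟩
    rcases (helical_arc_iff e f _ _).1 harc with h | h <;> rw [h] at hone
    · exact hone.2 hlast
    · exact hone.1 hlast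

theorem hasOmSRValencyTwo_two [Finite G] {a : G}
    (ha : ∀ g : G, g ∈ Subgroup.zpowers a) (ha2 : a * a ≠ 1) :
    HasOmSRValencyTwo G 2 := by
  have hinv : a⁻¹ ≠ a := fun h => ha2 (by rw [← mul_inv_cancel a, h])
  have hone : a ≠ 1 := fun h => ha2 (by simp [h])
  have h11 : (1 : ZMod 2) + 1 = 0 := rfl
  let e : ZMod 2 → G := fun i => if i = 0 then a⁻¹ else a
  let f : ZMod 2 → G := fun i => if i = 0 then 1 else a
  have cases2 : ∀ i : ZMod 2, i = 0 ∨ i = 1 := by decide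
  refine hasOmSRValencyTwo_of_helical e f (fun i => ?_) (fun i _ => ?_)
    (fun g => by simpa [e] using ha g) fun σ hσ g => ?_
  · rcases cases2 i with rfl | rfl
    · simp only [e, if_true, ne_eq, ← mul_inv_rev, inv_eq_one]
      exact ha2
    · simpa [e] using ha2
  · rcases cases2 i with rfl | rfl <;> simpa [f, h11] using hone
  · rcases cases2 (σ (g, 0)).2 with h | h
    · exact h
    exfalso
    obtain ⟨k, hk⟩ : ∃ k, σ (g, 0) = (k, 1) := ⟨_, Prod.ext rfl h⟩
    by_cases ha3 : a * a * a = 1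
    · have hx := hσ.isDiamondSource_iff (g, 0)
      have hsq : a⁻¹ * a⁻¹ = a := by
        rw [← mul_inv_rev, inv_eq_iff_mul_eq_one, ha3]
      rw [hk, helical_isDiamondSource_iff, helical_isDiamondSource_iff] at hx
      simp [e, f, h11, hsq, hone] at hx
      exact ha2 hx
    · have hx := (hσ.isTriangular_iff (g, 0)).2 <| by
        intro y hy
        simp only [helical_arc_iff] at hy ⊢
        rcases hy with rfl | rfl
        · exact ⟨(a⁻¹ * g, 1), by simp [e, f], by simp [e, f, h11]⟩
        · exact ⟨(a * g, 0), by simp [e, f, h11], by simp [e, f]⟩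
      rw [hk] at hx
      obtain ⟨z, hz, hz'⟩ := hx (a * k, 1) ((helical_arc_iff e f _ _).2 (by simp [e]))
      rw [helical_arc_iff] at hz hz'
      rcases hz with rfl | rfl
      · simp [e, f, h11, ← mul_assoc] at hz'
        exact ha3 hz'
      · simp [e, f, h11, ← mul_assoc] at hz'
        exact ha2 hz'

end Helical

/-- Every finite cyclic group of order at least 3 admits an OmSR of valency two
for every integer `m ≥ 2`. -/
theorem cyclic_card_ge_three_omsr_valency_two
    (G : Type*) [Group G] [Fintype G] [IsCyclic G]
    (hG : 3 ≤ Fintype.card G)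
    (m : ℕ) (hm : 2 ≤ m) :
    HasOmSRValencyTwo G m := by
  obtain ⟨a, ha⟩ := IsCyclic.exists_generator (α := G)
  have ha2 : a * a ≠ 1 := by
    intro h
    have hle := orderOf_le_of_pow_eq_one two_pos ((pow_two a).trans h)
    rw [orderOf_eq_card_of_forall_mem_zpowers ha, Nat.card_eq_fintype_card] at hle
    omega
  obtain rfl | hm3 := hm.eq_or_lt
  · exact hasOmSRValencyTwo_two ha ha2
  · exact hasOmSRValencyTwo_of_three_le ha ha2 hm3
end

section
/- Let G be a finite cyclic group generated by an element a of order at least 3, and let m ≥ 2 be an integer. Define subsets T_{i,j} ⊆ G for i,j ∈ Z_m by: T_{0,0} = {a}; T_{i,i} = {a^{-1}} for every i ∈ Z_m with i ≠ 0; T_{i,i+1} = {1} for every i ∈ Z_m with i ≠ m−1; T_{m−1,0} = {a}; and T_{i,j} = ∅ otherwise. Let Γ_m = Cay(G, T_{i,j} : i,j ∈ Z_m) be the corresponding m-Cayley digraph. Then Γ_m is oriented, regular of valency two, and its full automorphism group is exactly the group {R(h) : h ∈ G} of right translations; in particular Γ_m is an OmSR over G of valency two. -/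
/-- Two distinct out-neighbours of `x` have a common out-neighbour. -/
def HasCommonOut {V : Type*} (A : V → V → Prop) (x : V) : Prop :=
  ∃ y z w, A x y ∧ A x z ∧ y ≠ z ∧ A y w ∧ A z w

/-- Every arc leaving `x` lies on a directed triangle. -/
def ArcsInTriangle {V : Type*} (A : V → V → Prop) (x : V) : Prop :=
  ∀ y, A x y → ∃ w, A y w ∧ A w x

namespace IsDigraphAuto

variable {V : Type*} {A : V → V → Prop} {σ : Equiv.Perm V}

theorem apply_iff (h : IsDigraphAuto A σ) {x y : V} : A (σ x) (σ y) ↔ A x y := h x y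

theorem hasCommonOut_iff (h : IsDigraphAuto A σ) (x : V) :
    HasCommonOut A (σ x) ↔ HasCommonOut A x := by
  constructor
  · rintro ⟨y, z, w, hy, hz, hyz, hyw, hzw⟩
    obtain ⟨y, rfl⟩ := σ.surjective y
    obtain ⟨z, rfl⟩ := σ.surjective z
    obtain ⟨w, rfl⟩ := σ.surjective w
    exact ⟨y, z, w, h.apply_iff.1 hy, h.apply_iff.1 hz, ne_of_apply_ne σ hyz,
      h.apply_iff.1 hyw, h.apply_iff.1 hzw⟩
  · rintro ⟨y, z, w, hy, hz, hyz, hyw, hzw⟩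
    exact ⟨σ y, σ z, σ w, h.apply_iff.2 hy, h.apply_iff.2 hz, σ.injective.ne hyz,
      h.apply_iff.2 hyw, h.apply_iff.2 hzw⟩

theorem arcsInTriangle_iff (h : IsDigraphAuto A σ) (x : V) :
    ArcsInTriangle A (σ x) ↔ ArcsInTriangle A x := by
  constructor
  · intro hx y hy
    obtain ⟨w, hyw, hwx⟩ := hx (σ y) (h.apply_iff.2 hy)
    obtain ⟨w, rfl⟩ := σ.surjective w
    exact ⟨w, h.apply_iff.1 hyw, h.apply_iff.1 hwx⟩
  · intro hx y hy
    obtain ⟨y, rfl⟩ := σ.surjective y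
    obtain ⟨w, hyw, hwx⟩ := hx y (h.apply_iff.1 hy)
    exact ⟨σ w, h.apply_iff.2 hyw, h.apply_iff.2 hwx⟩

end IsDigraphAuto

namespace CyclicOmSR

variable {G : Type*} [Group G] {m : ℕ}

/-- The arc from `x` staying in the same orbit of right translations. -/
def loopStep (a : G) (x : G × ZMod m) : G × ZMod m :=
  (if x.2 = 0 then a * x.1 else a⁻¹ * x.1, x.2)

/-- The arc from `x` to the next orbit of right translations. -/
def nextStep (a : G) (x : G × ZMod m) : G × ZMod m :=
  (if x.2 = -1 then a * x.1 else x.1, x.2 + 1)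

/-- The digraph whose arcs are the two kinds of steps. -/
def StepArc (a : G) (x y : G × ZMod m) : Prop :=
  y = loopStep a x ∨ y = nextStep a x

@[simp] theorem loopStep_snd (a : G) (x : G × ZMod m) : (loopStep a x).2 = x.2 := rfl

@[simp] theorem nextStep_snd (a : G) (x : G × ZMod m) : (nextStep a x).2 = x.2 + 1 := rfl

theorem loopStep_injective (a : G) :
    Function.Injective (loopStep a : G × ZMod m → G × ZMod m) := by
  rintro ⟨g, i⟩ ⟨k, j⟩ h
  obtain rfl : i = j := congrArg Prod.snd h
  by_cases hi : i = 0 <;> simpa [loopStep, hi] using h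

theorem nextStep_injective (a : G) :
    Function.Injective (nextStep a : G × ZMod m → G × ZMod m) := by
  rintro ⟨g, i⟩ ⟨k, j⟩ h
  obtain rfl : i = j := add_right_cancel (congrArg Prod.snd h)
  by_cases hi : i = -1 <;> simpa [nextStep, hi] using h

theorem nextStep_surjective (a : G) :
    Function.Surjective (nextStep a : G × ZMod m → G × ZMod m) := by
  rintro ⟨g, i⟩
  by_cases hi : i = 0
  · exact ⟨(a⁻¹ * g, -1), by simp [nextStep, hi]⟩
  · exact ⟨(g, i - 1), by simp [nextStep, sub_eq_iff_eq_add, hi]⟩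

theorem loopStep_surjective (a : G) :
    Function.Surjective (loopStep a : G × ZMod m → G × ZMod m) := by
  rintro ⟨g, i⟩
  by_cases hi : i = 0
  · exact ⟨(a⁻¹ * g, i), by simp [loopStep, hi]⟩
  · exact ⟨(a * g, i), by simp [loopStep, hi]⟩

theorem loopStep_rightTransl (a h : G) (x : G × ZMod m) :
    loopStep a (rightTransl m h x) = rightTransl m h (loopStep a x) := by
  by_cases hi : x.2 = 0 <;> simp [loopStep, rightTransl, hi, mul_assoc]

theorem nextStep_rightTransl (a h : G) (x : G × ZMod m) :
    nextStep a (rightTransl m h x) = rightTransl m h (nextStep a x) := by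
  by_cases hi : x.2 = -1 <;> simp [nextStep, rightTransl, hi, mul_assoc]

theorem isDigraphAuto_rightTransl (a h : G) :
    IsDigraphAuto (StepArc a) (rightTransl m h) := by
  intro x y
  simp only [StepArc, loopStep_rightTransl, nextStep_rightTransl, EmbeddingLike.apply_eq_iff_eq]

theorem loopStep_zero (a g : G) : loopStep a (g, (0 : ZMod m)) = (a * g, 0) := by simp [loopStep]

theorem loopStep_one_of_two (a g : G) : loopStep a (g, (1 : ZMod 2)) = (a⁻¹ * g, 1) := rfl

theorem nextStep_zero_of_two (a g : G) : nextStep a (g, (0 : ZMod 2)) = (g, 1) := rfl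

theorem nextStep_one_of_two (a g : G) : nextStep a (g, (1 : ZMod 2)) = (a * g, 0) := rfl

theorem eq_zero_or_eq_one_of_two (i : ZMod 2) : i = 0 ∨ i = 1 := by decide +revert

variable [Fact (1 < m)]

theorem loopStep_ne_nextStep (a : G) (x y : G × ZMod m) (h : x.2 = y.2) :
    loopStep a x ≠ nextStep a y := fun e => by
  simpa [h] using congrArg Prod.snd e

theorem ncard_stepArc_out (a : G) (x : G × ZMod m) : {y | StepArc a x y}.ncard = 2 :=
  Set.ncard_pair (loopStep_ne_nextStep a x x rfl)

theorem ncard_stepArc_in (a : G) (x : G × ZMod m) : {y | StepArc a y x}.ncard = 2 := by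
  obtain ⟨y, rfl⟩ := loopStep_surjective a x
  obtain ⟨z, hz⟩ := nextStep_surjective a (loopStep a y)
  have hyz : y ≠ z := by
    rintro rfl
    exact loopStep_ne_nextStep a y y rfl hz.symm
  convert Set.ncard_pair hyz using 2
  ext w
  simp only [StepArc, Set.mem_ofPred_eq, Set.mem_insert_iff, Set.mem_singleton_iff]
  nth_rw 2 [← hz]
  rw [(loopStep_injective a).eq_iff, (nextStep_injective a).eq_iff, eq_comm, eq_comm (a := z)]

theorem ne_one_of_three_le_orderOf {a : G} (ha : 3 ≤ orderOf a) : a ≠ 1 := by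
  rintro rfl
  simp at ha

theorem mul_self_ne_one_of_three_le_orderOf {a : G} (ha : 3 ≤ orderOf a) : a * a ≠ 1 := fun h => by
  have := orderOf_le_of_pow_eq_one (x := a) two_pos (by rwa [pow_two])
  omega

theorem eq_two_of_one_add_one_eq_zero (h : (1 + 1 : ZMod m) = 0) : m = 2 := by
  have hdvd : m ∣ 2 := (ZMod.natCast_eq_zero_iff 2 m).1 (by rw [← h]; norm_num)
  exact le_antisymm (Nat.le_of_dvd two_pos hdvd) (Fact.out (p := 1 < m))

theorem isOrientedRel_stepArc {a : G} (ha : 3 ≤ orderOf a) :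
    IsOrientedRel (StepArc a : G × ZMod m → _ → Prop) := by
  have h1 := ne_one_of_three_le_orderOf ha
  have h2 := mul_self_ne_one_of_three_le_orderOf ha
  have h2' : a⁻¹ * a⁻¹ ≠ 1 := fun h => h2 (by simpa [← mul_inv_rev] using h)
  rintro ⟨g, i⟩ y (rfl | rfl) (h | h)
  · by_cases hi : i = 0 <;> simp [loopStep, hi, ← mul_assoc, h2, h2'] at h
  · simpa using congrArg Prod.snd h
  · simpa using congrArg Prod.snd h
  · have hi : i + 1 + 1 = i := (congrArg Prod.snd h).symm
    obtain rfl := eq_two_of_one_add_one_eq_zero (m := m) (by linear_combination hi)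
    obtain rfl | rfl := eq_zero_or_eq_one_of_two i <;>
      simp [nextStep_zero_of_two, nextStep_one_of_two, h1] at h

theorem hasCommonOut_iff {a : G} (x : G × ZMod m) :
    HasCommonOut (StepArc a) x ↔
      loopStep a (loopStep a x) = nextStep a (nextStep a x) ∨
        nextStep a (loopStep a x) = loopStep a (nextStep a x) := by
  constructor
  · rintro ⟨y, z, w, rfl | rfl, rfl | rfl, hyz, rfl | rfl, h | h⟩
    all_goals first
      | exact absurd rfl hyz
      | exact Or.inl h
      | exact Or.inr h
      | exact Or.inl h.symm
      | exact Or.inr h.symm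
      | simpa using congrArg Prod.snd h
  · rintro (h | h)
    · exact ⟨_, _, _, .inl rfl, .inr rfl, loopStep_ne_nextStep a x x rfl, .inl rfl, .inr h⟩
    · exact ⟨_, _, _, .inl rfl, .inr rfl, loopStep_ne_nextStep a x x rfl, .inr rfl, .inl h⟩

theorem nextStep_loopStep_eq_iff {a : G} (ha : 3 ≤ orderOf a) (x : G × ZMod m) :
    nextStep a (loopStep a x) = loopStep a (nextStep a x) ↔ x.2 ≠ 0 ∧ x.2 ≠ -1 := by
  obtain ⟨g, i⟩ := x
  have h2 := mul_self_ne_one_of_three_le_orderOf ha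
  by_cases h0 : i = 0
  · have : a ≠ a⁻¹ := fun h => h2 (eq_inv_iff_mul_eq_one.1 h)
    simp [loopStep, nextStep, h0, this]
  · by_cases hl : i = -1
    · simp [loopStep, nextStep, hl, ← mul_assoc, h2]
    · simp [loopStep, nextStep, h0, hl, add_eq_zero_iff_eq_neg]

theorem snd_eq_zero_iff_of_two_lt {a : G} (ha : 3 ≤ orderOf a) (hm : 2 < m) (x : G × ZMod m) :
    x.2 = 0 ↔ ¬ HasCommonOut (StepArc a) x ∧ ∃ y, StepArc a x y ∧ HasCommonOut (StepArc a) y := by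
  have h11 : (1 + 1 : ZMod m) ≠ 0 := fun h => hm.ne' (eq_two_of_one_add_one_eq_zero h)
  have hC (y : G × ZMod m) : HasCommonOut (StepArc a) y ↔ y.2 ≠ 0 ∧ y.2 ≠ -1 := by
    rw [hasCommonOut_iff, nextStep_loopStep_eq_iff ha, or_iff_right]
    intro h
    exact h11 (by simpa [add_assoc] using congrArg Prod.snd h)
  have h1 : (1 : ZMod m) ≠ -1 := fun h => h11 (eq_neg_iff_add_eq_zero.1 h)
  simp only [hC, StepArc, or_and_right, exists_or, exists_eq_left, loopStep_snd, nextStep_snd]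
  by_cases h0 : x.2 = 0
  · simp [h0, h1]
  · by_cases hl : x.2 = -1 <;> simp [h0, hl]

theorem snd_eq_zero_iff_of_pow_three_eq_one {a : G} (ha : 3 ≤ orderOf a) (h3 : a ^ 3 = 1)
    (x : G × ZMod 2) : x.2 = 0 ↔ ¬ HasCommonOut (StepArc a) x := by
  have h1 := ne_one_of_three_le_orderOf ha
  have hinv : a⁻¹ * a⁻¹ = a := by
    rw [← mul_inv_rev, inv_eq_iff_mul_eq_one, ← pow_two, ← pow_succ, h3]
  rw [hasCommonOut_iff, nextStep_loopStep_eq_iff ha]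
  obtain ⟨g, i⟩ := x
  obtain rfl | rfl := eq_zero_or_eq_one_of_two i
  · simp [loopStep_zero, nextStep_zero_of_two,
      nextStep_one_of_two, h1]
  · simp [loopStep_one_of_two, nextStep_zero_of_two, nextStep_one_of_two,
      ← mul_assoc, hinv]

theorem snd_eq_zero_iff_of_pow_three_ne_one {a : G} (ha : 3 ≤ orderOf a) (h3 : a ^ 3 ≠ 1)
    (x : G × ZMod 2) : x.2 = 0 ↔ ¬ ArcsInTriangle (StepArc a) x := by
  have h2 := mul_self_ne_one_of_three_le_orderOf ha
  have h3' : a * a * a ≠ 1 := by rwa [← pow_two, ← pow_succ]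
  obtain ⟨g, i⟩ := x
  simp only [ArcsInTriangle, StepArc, forall_eq_or_imp, forall_eq, or_and_right, exists_or,
    exists_eq_left]
  obtain rfl | rfl := eq_zero_or_eq_one_of_two i
  · simp [loopStep_zero, loopStep_one_of_two, nextStep_zero_of_two, nextStep_one_of_two,
      ← mul_assoc, h2, h3']
  · simp [loopStep_zero, loopStep_one_of_two, nextStep_zero_of_two, nextStep_one_of_two]

theorem snd_apply_eq_zero {a : G} (ha : 3 ≤ orderOf a) {σ : Equiv.Perm (G × ZMod m)}
    (hσ : IsDigraphAuto (StepArc a) σ) {x : G × ZMod m} (hx : x.2 = 0) : (σ x).2 = 0 := by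
  rcases (Nat.succ_le_of_lt (Fact.out (p := 1 < m))).lt_or_eq with hm | rfl
  · rw [snd_eq_zero_iff_of_two_lt ha hm] at hx ⊢
    obtain ⟨hx, y, hxy, hy⟩ := hx
    exact ⟨by rwa [hσ.hasCommonOut_iff], σ y, hσ.apply_iff.2 hxy, (hσ.hasCommonOut_iff y).2 hy⟩
  · by_cases h3 : a ^ 3 = 1
    · rw [snd_eq_zero_iff_of_pow_three_eq_one ha h3] at hx ⊢
      rwa [hσ.hasCommonOut_iff]
    · rw [snd_eq_zero_iff_of_pow_three_ne_one ha h3] at hx ⊢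
      rwa [hσ.arcsInTriangle_iff]

theorem exists_eq_rightTransl {a : G} (ha : 3 ≤ orderOf a) (hgen : Subgroup.zpowers a = ⊤)
    {σ : Equiv.Perm (G × ZMod m)} (hσ : IsDigraphAuto (StepArc a) σ) :
    ∃ h : G, σ = rightTransl m h := by
  have hzero (g : G) : σ (a * g, 0) = loopStep a (σ (g, 0)) := by
    have harc : StepArc a (g, (0 : ZMod m)) (a * g, 0) := .inl (by simp [loopStep])
    refine ((hσ _ _).2 harc).resolve_right fun h => ?_
    have := congrArg Prod.snd h
    simp [snd_apply_eq_zero ha hσ] at this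
  have hbase (g : G) : σ (g, 0) = (g * (σ (1, 0)).1, 0) := by
    have hg : g ∈ Subgroup.zpowers a := hgen ▸ Subgroup.mem_top g
    have hmul (g : G) : (σ (a * g, 0)).1 = a * (σ (g, 0)).1 := by
      rw [hzero]; simp [loopStep, snd_apply_eq_zero ha hσ]
    refine Prod.ext ?_ (snd_apply_eq_zero ha hσ rfl)
    obtain ⟨k, rfl⟩ := Subgroup.mem_zpowers_iff.1 hg
    induction k with
    | zero => simp
    | succ k ih =>
      rw [add_comm, zpow_add, zpow_one, hmul, ih (hgen ▸ Subgroup.mem_top _), mul_assoc]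
    | pred k ih =>
      have := hmul (a ^ (-(k : ℤ) - 1))
      rw [← zpow_one_add, add_sub_cancel, ih (hgen ▸ Subgroup.mem_top _)] at this
      rw [← mul_right_inj a, ← this, ← mul_assoc, ← zpow_one_add, add_sub_cancel]
  refine ⟨(σ (1, 0)).1, ?_⟩
  set ρ := rightTransl m (σ (1, 0)).1 with hρ
  have hrow (k : ℕ) : ∀ x : G × ZMod m, x.2 = k → σ x = ρ x := by
    induction k with
    | zero =>
      rintro ⟨g, i⟩ hi
      obtain rfl : i = 0 := by simpa using hi
      rw [hbase]
      rfl
    | succ k ih =>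
      intro x hx
      obtain ⟨y, rfl⟩ := nextStep_surjective a x
      have hy : y.2 = k := by simpa using hx
      rcases (hσ y _).2 (.inr rfl) with h | h <;> rw [ih y hy] at h
      · rw [loopStep_rightTransl, ← hρ, ← ih _ ((loopStep_snd a y).trans hy)] at h
        exact absurd (σ.injective h).symm (loopStep_ne_nextStep a y y rfl)
      · rw [h, nextStep_rightTransl]
  have : NeZero m := ⟨by have := Fact.out (p := 1 < m); omega⟩
  exact Equiv.ext fun x => hrow x.2.val x (by simp)

theorem mCayleyArc_eq_stepArc {a : G} {T : ZMod m → ZMod m → Set G}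
    (hT : ∀ i j : ZMod m, T i j =
      {t | (i = 0 ∧ j = 0 ∧ t = a) ∨
           (i ≠ 0 ∧ j = i ∧ t = a⁻¹) ∨
           (i ≠ ((m - 1 : ℕ) : ZMod m) ∧ j = i + 1 ∧ t = 1) ∨
           (i = ((m - 1 : ℕ) : ZMod m) ∧ j = 0 ∧ t = a)}) :
    mCayleyArc T = StepArc a := by
  have hlast : ((m - 1 : ℕ) : ZMod m) = -1 := by
    rw [Nat.cast_sub (Fact.out (p := 1 < m)).le]; simp
  ext ⟨g, i⟩ ⟨k, j⟩
  simp only [mCayleyArc, StepArc, hT, hlast, loopStep, nextStep, Set.mem_ofPred_eq, Prod.mk.injEq]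
  constructor
  · rintro ⟨t, ⟨rfl, rfl, rfl⟩ | ⟨hi, rfl, rfl⟩ | ⟨hi, rfl, rfl⟩ | ⟨rfl, rfl, rfl⟩, rfl⟩ <;>
      simp [*]
  · rintro (⟨rfl, rfl⟩ | ⟨rfl, rfl⟩)
    · by_cases hj : j = 0 <;> simp [hj]
    · by_cases hi : i = -1
      · exact ⟨a, by simp [hi], by simp [hi]⟩
      · exact ⟨1, by simp [hi], by simp [hi]⟩

end CyclicOmSR

/-- The explicit construction of Lemma 3.1 for a cyclic group `G = ⟨a⟩` with
`o(a) ≥ 3` and `m ≥ 2`: with `T_{0,0} = {a}`, `T_{i,i} = {a⁻¹}` for `i ≠ 0`,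
`T_{i,i+1} = {1}` for `i ≠ m-1`, `T_{m-1,0} = {a}` and `T_{i,j} = ∅` otherwise,
the `m`-Cayley digraph `Γ_m = Cay(G, T_{i,j})` is an OmSR over `G` of
valency two. -/
theorem cyclic_explicit_omsr
    (G : Type*) [Group G] [Fintype G] (a : G)
    (hgen : Subgroup.zpowers a = ⊤) (ha : 3 ≤ orderOf a)
    (m : ℕ) (hm : 2 ≤ m)
    (T : ZMod m → ZMod m → Set G)
    (hT : ∀ i j : ZMod m, T i j =
      {t | (i = 0 ∧ j = 0 ∧ t = a) ∨
           (i ≠ 0 ∧ j = i ∧ t = a⁻¹) ∨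
           (i ≠ ((m - 1 : ℕ) : ZMod m) ∧ j = i + 1 ∧ t = 1) ∨
           (i = ((m - 1 : ℕ) : ZMod m) ∧ j = 0 ∧ t = a)}) :
    IsOrientedRel (mCayleyArc T) ∧
    (∀ x : G × ZMod m, {y | mCayleyArc T x y}.ncard = 2) ∧
    (∀ x : G × ZMod m, {y | mCayleyArc T y x}.ncard = 2) ∧
    (∀ σ : Equiv.Perm (G × ZMod m),
      IsDigraphAuto (mCayleyArc T) σ ↔ ∃ h : G, σ = rightTransl m h) := by
  have : Fact (1 < m) := ⟨hm⟩
  rw [CyclicOmSR.mCayleyArc_eq_stepArc hT]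
  refine ⟨CyclicOmSR.isOrientedRel_stepArc ha, CyclicOmSR.ncard_stepArc_out a,
    CyclicOmSR.ncard_stepArc_in a, fun σ =>
      ⟨CyclicOmSR.exists_eq_rightTransl ha hgen, ?_⟩⟩
  rintro ⟨h, rfl⟩
  exact CyclicOmSR.isDigraphAuto_rightTransl a h
end
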